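/- arXiv:1907.02551 — 4 statements merged into one kernel-verified Lean document; each statement's English description precedes it below -/
import Mathlib

section
/- Let p be a probability distribution on A × B × C × X × Y × Z compatible with the triangle causal structure, i.e. there exist distributions p_A, p_B, p_C and conditional distributions p_{X|BC}, p_{Y|AC}, p_{Z|AB} with p(a,b,c,x,y,z) = p_A(a)·p_B(b)·p_C(c)·p_{X|BC}(x|b,c)·p_{Y|AC}(y|a,c)·p_{Z|AB}(z|a,b), where A, B, C each have cardinality d_u ≥ 2 and X, Y, Z each have cardinality d_o ≥ 2. Then for every real q > 1 the observed marginal on X × Y × Z satisfies −S_q(X) − S_q(Y) − S_q(Z) + S_q(XY) + S_q(XZ) ≥ B_1(q,d_o,d_u), where B_1(q,d_o,d_u) = −(1/(q−1))·(1−d_o^{1−q})·(2−d_o^{1−q}−d_u^{1−q}). -/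
open Finset

/-- Tsallis entropy of order `q` of a distribution `p` on a finite type,
with the sum restricted to the support of `p`. -/
noncomputable def tsallisEnt {α : Type*} [Fintype α] (q : ℝ) (p : α → ℝ) : ℝ :=
  (1 / (1 - q)) * ((∑ x ∈ univ.filter (fun x => 0 < p x), p x ^ q) - 1)

/-- The bound `B_1(q,d_o,d_u) = −(1/(q−1))·(1−d_o^{1−q})·(2−d_o^{1−q}−d_u^{1−q})`. -/
noncomputable def B1 (q dO dU : ℝ) : ℝ :=
  -(1 / (q - 1)) * (1 - dO ^ (1 - q)) * (2 - dO ^ (1 - q) - dU ^ (1 - q))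

lemma tt_ent {α : Type*} [Fintype α] (q : ℝ) (hq : 1 < q) (p : α → ℝ) (h0 : ∀ x, 0 ≤ p x) :
    tsallisEnt q p = (1 / (q - 1)) * (1 - ∑ x, p x ^ q) := by
  unfold tsallisEnt
  have : ∑ x ∈ univ.filter (fun x => 0 < p x), p x ^ q = ∑ x, p x ^ q := by
    rw [Finset.sum_filter]
    refine Finset.sum_congr rfl fun x _ => ?_
    split_ifs with h
    · rfl
    · have : p x = 0 := le_antisymm (not_lt.mp h) (h0 x)
      rw [this, Real.zero_rpow (by linarith)]
  rw [this]
  have h1 : 1 - q ≠ 0 := by linarith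
  have h2 : q - 1 ≠ 0 := by linarith
  field_simp
  ring

lemma tt_pow_le {q : ℝ} (hq : 1 < q) {x : ℝ} (h0 : 0 ≤ x) (h1 : x ≤ 1) : x ^ q ≤ x := by
  rcases h0.eq_or_lt with h | h
  · rw [← h, Real.zero_rpow (by linarith)]
  · simpa using Real.rpow_le_rpow_of_exponent_ge h h1 hq.le

lemma tt_le_one {α : Type*} [Fintype α] {q : ℝ} (hq : 1 < q) (p : α → ℝ) (h0 : ∀ x, 0 ≤ p x)
    (h1 : ∑ x, p x = 1) : ∑ x, p x ^ q ≤ 1 := by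
  rw [← h1]
  refine Finset.sum_le_sum fun x _ => tt_pow_le hq (h0 x) ?_
  rw [← h1]
  exact Finset.single_le_sum (f := p) (fun i _ => h0 i) (mem_univ x)

lemma tt_low {α : Type*} [Fintype α] {q : ℝ} (hq : 1 < q) (p : α → ℝ) (h0 : ∀ x, 0 ≤ p x)
    (h1 : ∑ x, p x = 1) (d : ℕ) (hd : 2 ≤ d) (hc : Fintype.card α = d) :
    (d : ℝ) ^ (1 - q) ≤ ∑ x, p x ^ q := by
  have h := Real.rpow_sum_le_const_mul_sum_rpow (univ : Finset α) p hq.le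
  simp only [abs_of_nonneg (h0 _), h1, Real.one_rpow, Finset.card_univ, hc] at h
  have hd0 : (0 : ℝ) < d := by
    have : 0 < d := by omega
    exact_mod_cast this
  have e : (d : ℝ) ^ (1 - q) = ((d : ℝ) ^ (q - 1))⁻¹ := by
    rw [← Real.rpow_neg hd0.le]; congr 1; ring
  rw [e, inv_le_iff_one_le_mul₀ (Real.rpow_pos_of_pos hd0 _)]
  linarith [mul_comm ((d : ℝ) ^ (q - 1)) (∑ x, p x ^ q)]

lemma tt_ssa1 {α γ : Type*} [Fintype α] [Fintype γ] {q : ℝ} (hq : 1 < q) (M : α → γ → ℝ)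
    (h0 : ∀ x c, 0 ≤ M x c) (h1 : ∑ x, ∑ c, M x c = 1) :
    ∑ x, (∑ c, M x c) ^ q + ∑ c, (∑ x, M x c) ^ q ≤ ∑ x, ∑ c, M x c ^ q + 1 := by
  set t : α → ℝ := fun x => ∑ c, M x c with ht
  have t0 : ∀ x, 0 ≤ t x := fun x => Finset.sum_nonneg fun c _ => h0 x c
  have t1 : ∀ x, t x ≤ 1 := fun x => by
    rw [← h1]; exact Finset.single_le_sum (f := t) (fun i _ => t0 i) (mem_univ x)
  set k : α → γ → ℝ := fun x c => M x c / t x with hk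
  have k0 : ∀ x c, 0 ≤ k x c := fun x c => div_nonneg (h0 x c) (t0 x)
  have hM : ∀ x c, M x c = t x * k x c := by
    intro x c
    by_cases h : t x = 0
    · rw [h, zero_mul]
      exact (Finset.sum_eq_zero_iff_of_nonneg (fun c _ => h0 x c)).mp h c (mem_univ c)
    · simp only [hk]; field_simp
  have hK : ∀ x, ∑ c, k x c ^ q ≤ 1 := by
    intro x
    by_cases h : t x = 0
    · simp [hk, h, Real.zero_rpow (show q ≠ 0 by linarith)]
    · apply tt_le_one hq _ (k0 x)
      simp only [hk]
      rw [← Finset.sum_div]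
      exact div_self h
  have hJ : ∑ c, (∑ x, M x c) ^ q ≤ ∑ x, t x * ∑ c, k x c ^ q := by
    simp only [Finset.mul_sum]
    rw [Finset.sum_comm]
    refine Finset.sum_le_sum fun c _ => ?_
    simp only [hM]
    exact Real.rpow_arith_mean_le_arith_mean_rpow univ t (fun x => k x c) (fun i _ => t0 i) h1
      (fun i _ => k0 i c) hq.le
  have hE : ∑ x, ∑ c, M x c ^ q = ∑ x, t x ^ q * ∑ c, k x c ^ q := by
    refine Finset.sum_congr rfl fun x _ => ?_
    rw [Finset.mul_sum]
    refine Finset.sum_congr rfl fun c _ => ?_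
    rw [hM, Real.mul_rpow (t0 x) (k0 x c)]
  have hS : ∑ x, (t x ^ q + t x * ∑ c, k x c ^ q) ≤ ∑ x, (t x ^ q * ∑ c, k x c ^ q + t x) := by
    refine Finset.sum_le_sum fun x _ => ?_
    nlinarith [mul_nonneg (sub_nonneg.mpr (tt_pow_le hq (t0 x) (t1 x))) (sub_nonneg.mpr (hK x))]
  rw [Finset.sum_add_distrib, Finset.sum_add_distrib] at hS
  have h1' : ∑ x, t x = 1 := h1
  rw [hE]
  linarith

lemma tt_ssa2 {α γ : Type*} [Fintype α] [Fintype γ] {q : ℝ} (hq : 1 < q) (M : α → γ → ℝ)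
    (h0 : ∀ x c, 0 ≤ M x c) :
    ∑ x, (∑ c, M x c) ^ q + ∑ c, (∑ x, M x c) ^ q
      ≤ ∑ x, ∑ c, M x c ^ q + (∑ x, ∑ c, M x c) ^ q := by
  set N := ∑ x, ∑ c, M x c with hN
  have r0 : ∀ x, 0 ≤ ∑ c, M x c := fun x => Finset.sum_nonneg fun c _ => h0 x c
  have c0 : ∀ c, 0 ≤ ∑ x, M x c := fun c => Finset.sum_nonneg fun x _ => h0 x c
  have N0 : 0 ≤ N := Finset.sum_nonneg fun x _ => r0 x
  by_cases h : N = 0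
  · have hz : ∀ x c, M x c = 0 := by
      intro x c
      have := (Finset.sum_eq_zero_iff_of_nonneg (fun x _ => r0 x)).mp h x (mem_univ x)
      exact (Finset.sum_eq_zero_iff_of_nonneg (fun c _ => h0 x c)).mp this c (mem_univ c)
    simp [hz, h, Real.zero_rpow (show q ≠ 0 by linarith)]
  · have Np : 0 < N := lt_of_le_of_ne N0 (Ne.symm h)
    have key := tt_ssa1 hq (fun x c => M x c / N) (fun x c => div_nonneg (h0 x c) N0)
      (by simp only [← Finset.sum_div]; exact div_self h)
    simp only [← Finset.sum_div, Real.div_rpow (h0 _ _) N0, Real.div_rpow (r0 _) N0,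
      Real.div_rpow (c0 _) N0] at key
    have hp : 0 < N ^ q := Real.rpow_pos_of_pos Np q
    rw [← add_div, div_add_one hp.ne', div_le_div_iff_of_pos_right hp] at key
    exact key

/-- strong subadditivity, conditioning on the last index -/
lemma tt_ssa3 {α β γ : Type*} [Fintype α] [Fintype β] [Fintype γ] {q : ℝ} (hq : 1 < q)
    (r : β → α → γ → ℝ) (h0 : ∀ y x c, 0 ≤ r y x c) :
    ∑ y, ∑ x, (∑ c, r y x c) ^ q + ∑ y, ∑ c, (∑ x, r y x c) ^ q
      ≤ ∑ y, ∑ x, ∑ c, r y x c ^ q + ∑ y, (∑ x, ∑ c, r y x c) ^ q := by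
  rw [← Finset.sum_add_distrib, ← Finset.sum_add_distrib]
  exact Finset.sum_le_sum fun y _ => tt_ssa2 hq (r y) (h0 y)

lemma tt_ci {α β γ : Type*} [Fintype α] [Fintype β] [Fintype γ] {q : ℝ} (hq : 1 < q)
    (w : γ → ℝ) (w0 : ∀ c, 0 ≤ w c) (w1 : ∑ c, w c = 1)
    (f : γ → α → ℝ) (f0 : ∀ c x, 0 ≤ f c x) (f1 : ∀ c, ∑ x, f c x = 1)
    (g : γ → β → ℝ) (g0 : ∀ c x, 0 ≤ g c x) (g1 : ∀ c, ∑ x, g c x = 1)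
    (d : ℕ) (hd : 2 ≤ d) (ha : Fintype.card α = d) (hb : Fintype.card β = d) :
    ∑ c, w c ^ q - ∑ c, ∑ x, (w c * f c x) ^ q - ∑ c, ∑ y, (w c * g c y) ^ q
      + ∑ c, ∑ x, ∑ y, (w c * f c x * g c y) ^ q
      ≤ (1 - (d : ℝ) ^ (1 - q)) * (1 - (d : ℝ) ^ (1 - q)) := by
  have e : ∑ c, w c ^ q - ∑ c, ∑ x, (w c * f c x) ^ q - ∑ c, ∑ y, (w c * g c y) ^ q
      + ∑ c, ∑ x, ∑ y, (w c * f c x * g c y) ^ q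
      = ∑ c, w c ^ q * ((1 - ∑ x, f c x ^ q) * (1 - ∑ y, g c y ^ q)) := by
    rw [← Finset.sum_sub_distrib, ← Finset.sum_sub_distrib, ← Finset.sum_add_distrib]
    refine Finset.sum_congr rfl fun c _ => ?_
    simp only [Real.mul_rpow (mul_nonneg (w0 _) (f0 _ _)) (g0 _ _),
      Real.mul_rpow (w0 _) (f0 _ _), Real.mul_rpow (w0 _) (g0 _ _), ← Finset.mul_sum,
      ← Finset.sum_mul]
    ring
  rw [e]
  have hT := tt_le_one hq w w0 w1
  have hdd : 0 ≤ (1 - (d : ℝ) ^ (1 - q)) := by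
    have h := Real.rpow_le_one_of_one_le_of_nonpos (x := (d : ℝ)) (z := 1 - q)
      (by exact_mod_cast (by omega : 1 ≤ d)) (by linarith)
    linarith
  calc _ ≤ ∑ c, w c ^ q * ((1 - (d : ℝ) ^ (1 - q)) * (1 - (d : ℝ) ^ (1 - q))) := by
        refine Finset.sum_le_sum fun c _ => ?_
        have a1 := tt_low hq (f c) (f0 c) (f1 c) d hd ha
        have a2 := tt_low hq (g c) (g0 c) (g1 c) d hd hb
        have a3 := tt_le_one hq (g c) (g0 c) (g1 c)
        refine mul_le_mul_of_nonneg_left ?_ (Real.rpow_nonneg (w0 c) q)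
        exact mul_le_mul (by linarith) (by linarith) (by linarith) hdd
    _ = (∑ c, w c ^ q) * ((1 - (d : ℝ) ^ (1 - q)) * (1 - (d : ℝ) ^ (1 - q))) := by
        rw [Finset.sum_mul]
    _ ≤ _ := mul_le_of_le_one_left (mul_nonneg hdd hdd) hT

lemma tt_super {α : Type*} [Fintype α] {q : ℝ} (hq : 1 < q) (v : α → ℝ) (h0 : ∀ x, 0 ≤ v x) :
    ∑ x, v x ^ q ≤ (∑ x, v x) ^ q := by
  set N := ∑ x, v x with hN
  have N0 : 0 ≤ N := Finset.sum_nonneg fun x _ => h0 x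
  by_cases h : N = 0
  · have hz : ∀ x, v x = 0 := fun x =>
      (Finset.sum_eq_zero_iff_of_nonneg (fun x _ => h0 x)).mp h x (mem_univ x)
    simp [hz, h, Real.zero_rpow (show q ≠ 0 by linarith)]
  · have Np : 0 < N := lt_of_le_of_ne N0 (Ne.symm h)
    have key := tt_le_one hq (fun x => v x / N) (fun x => div_nonneg (h0 x) N0)
      (by rw [← Finset.sum_div]; exact div_self h)
    simp only [Real.div_rpow (h0 _) N0, ← Finset.sum_div] at key
    rwa [div_le_one (Real.rpow_pos_of_pos Np q)] at key

/-- For any distribution compatible with the triangle causal structure, with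
unobserved nodes of cardinality `d_u ≥ 2` and observed nodes of cardinality
`d_o ≥ 2`, and any `q > 1`:
`−S_q(X) − S_q(Y) − S_q(Z) + S_q(XY) + S_q(XZ) ≥ B_1(q,d_o,d_u)`. -/
theorem triangle_tsallis_ineq_one
    {A B C X Y Z : Type*} [Fintype A] [Fintype B] [Fintype C]
    [Fintype X] [Fintype Y] [Fintype Z]
    (dU dO : ℕ) (hdU : 2 ≤ dU) (hdO : 2 ≤ dO)
    (hA : Fintype.card A = dU) (hB : Fintype.card B = dU) (hC : Fintype.card C = dU)
    (hX : Fintype.card X = dO) (hY : Fintype.card Y = dO) (hZ : Fintype.card Z = dO)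
    (pA : A → ℝ) (hpA0 : ∀ a, 0 ≤ pA a) (hpA1 : ∑ a, pA a = 1)
    (pB : B → ℝ) (hpB0 : ∀ b, 0 ≤ pB b) (hpB1 : ∑ b, pB b = 1)
    (pC : C → ℝ) (hpC0 : ∀ c, 0 ≤ pC c) (hpC1 : ∑ c, pC c = 1)
    (pX : B → C → X → ℝ) (hpX0 : ∀ b c x, 0 ≤ pX b c x) (hpX1 : ∀ b c, ∑ x, pX b c x = 1)
    (pY : A → C → Y → ℝ) (hpY0 : ∀ a c y, 0 ≤ pY a c y) (hpY1 : ∀ a c, ∑ y, pY a c y = 1)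
    (pZ : A → B → Z → ℝ) (hpZ0 : ∀ a b z, 0 ≤ pZ a b z) (hpZ1 : ∀ a b, ∑ z, pZ a b z = 1)
    (p : A × B × C × X × Y × Z → ℝ)
    (hp : ∀ a b c x y z, p (a, b, c, x, y, z)
      = pA a * pB b * pC c * pX b c x * pY a c y * pZ a b z)
    (q : ℝ) (hq : 1 < q) :
    - tsallisEnt q (fun x => ∑ a, ∑ b, ∑ c, ∑ y, ∑ z, p (a, b, c, x, y, z))
      - tsallisEnt q (fun y => ∑ a, ∑ b, ∑ c, ∑ x, ∑ z, p (a, b, c, x, y, z))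
      - tsallisEnt q (fun z => ∑ a, ∑ b, ∑ c, ∑ x, ∑ y, p (a, b, c, x, y, z))
      + tsallisEnt q (fun w : X × Y => ∑ a, ∑ b, ∑ c, ∑ z, p (a, b, c, w.1, w.2, z))
      + tsallisEnt q (fun w : X × Z => ∑ a, ∑ b, ∑ c, ∑ y, p (a, b, c, w.1, y, w.2))
      ≥ B1 q dO dU := by
  set f : C → X → ℝ := fun c x => ∑ b, pB b * pX b c x with hf
  set g : C → Y → ℝ := fun c y => ∑ a, pA a * pY a c y with hg
  set h : B → Z → ℝ := fun b z => ∑ a, pA a * pZ a b z with hh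
  set s : C → X → Z → ℝ := fun c x z => pC c * ∑ b, pB b * pX b c x * h b z with hs
  have f0 : ∀ c x, 0 ≤ f c x := fun c x =>
    Finset.sum_nonneg fun b _ => mul_nonneg (hpB0 b) (hpX0 b c x)
  have g0 : ∀ c x, 0 ≤ g c x := fun c x =>
    Finset.sum_nonneg fun b _ => mul_nonneg (hpA0 b) (hpY0 b c x)
  have h0 : ∀ c x, 0 ≤ h c x := fun c x =>
    Finset.sum_nonneg fun b _ => mul_nonneg (hpA0 b) (hpZ0 b c x)
  have s0 : ∀ c x z, 0 ≤ s c x z := fun c x z =>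
    mul_nonneg (hpC0 c) (Finset.sum_nonneg fun b _ =>
      mul_nonneg (mul_nonneg (hpB0 b) (hpX0 b c x)) (h0 b z))
  have f1 : ∀ c, ∑ x, f c x = 1 := fun c => by
    simp only [hf]; rw [Finset.sum_comm]; simp only [← Finset.mul_sum, hpX1, mul_one, hpB1]
  have g1 : ∀ c, ∑ x, g c x = 1 := fun c => by
    simp only [hg]; rw [Finset.sum_comm]; simp only [← Finset.mul_sum, hpY1, mul_one, hpA1]
  have h1 : ∀ c, ∑ x, h c x = 1 := fun c => by
    simp only [hh]; rw [Finset.sum_comm]; simp only [← Finset.mul_sum, hpZ1, mul_one, hpA1]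
  have sz : ∀ c x, ∑ z, s c x z = pC c * f c x := fun c x => by
    simp only [hs, ← Finset.mul_sum]; rw [Finset.sum_comm]
    simp only [← Finset.mul_sum, h1, mul_one, hf]
  have sx : ∀ c z, ∑ x, s c x z = pC c * ∑ b, pB b * h b z := fun c z => by
    simp only [hs, ← Finset.mul_sum]; rw [Finset.sum_comm]
    simp only [← Finset.mul_sum, ← Finset.sum_mul, hpX1, mul_one]
  have eXY : ∀ x y, ∑ a, ∑ b, ∑ c, ∑ z, p (a, b, c, x, y, z) = ∑ c, pC c * f c x * g c y := by
    intro x y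
    simp only [hp, ← Finset.mul_sum, hpZ1, mul_one, hf, hg]
    simp only [mul_assoc, Finset.sum_mul_sum]
    simp only [Finset.mul_sum]
    calc _ = ∑ a, ∑ c, ∑ b, pA a * (pB b * (pC c * (pX b c x * pY a c y))) :=
          Finset.sum_congr rfl fun a _ => Finset.sum_comm
      _ = ∑ c, ∑ a, ∑ b, pA a * (pB b * (pC c * (pX b c x * pY a c y))) := Finset.sum_comm
      _ = ∑ c, ∑ b, ∑ a, pA a * (pB b * (pC c * (pX b c x * pY a c y))) :=
          Finset.sum_congr rfl fun c _ => Finset.sum_comm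
      _ = _ := by
          refine Finset.sum_congr rfl fun c _ => Finset.sum_congr rfl fun b _ =>
            Finset.sum_congr rfl fun a _ => ?_
          ring
  have eXZ : ∀ x z, ∑ a, ∑ b, ∑ c, ∑ y, p (a, b, c, x, y, z) = ∑ c, s c x z := by
    intro x z
    have hp' : ∀ a b c y, p (a, b, c, x, y, z) = (pA a * pB b * pC c * pX b c x * pZ a b z) * pY a c y := by
      intro a b c y; rw [hp]; ring
    simp only [hp', ← Finset.mul_sum, hpY1, mul_one, hs, hh]
    simp only [Finset.mul_sum]
    calc _ = ∑ a, ∑ c, ∑ b, pA a * pB b * pC c * pX b c x * pZ a b z :=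
          Finset.sum_congr rfl fun a _ => Finset.sum_comm
      _ = ∑ c, ∑ a, ∑ b, pA a * pB b * pC c * pX b c x * pZ a b z := Finset.sum_comm
      _ = ∑ c, ∑ b, ∑ a, pA a * pB b * pC c * pX b c x * pZ a b z :=
          Finset.sum_congr rfl fun c _ => Finset.sum_comm
      _ = _ := by
          refine Finset.sum_congr rfl fun c _ => Finset.sum_congr rfl fun b _ =>
            Finset.sum_congr rfl fun a _ => ?_
          ring
  have eX : ∀ x, ∑ a, ∑ b, ∑ c, ∑ y, ∑ z, p (a, b, c, x, y, z) = ∑ c, pC c * f c x := by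
    intro x
    simp only [hp, ← Finset.mul_sum, hpZ1, hpY1, mul_one, hf]
    simp only [mul_assoc, ← Finset.mul_sum]
    rw [← Finset.sum_mul, hpA1, one_mul]
    simp only [Finset.mul_sum]
    rw [Finset.sum_comm]
    refine Finset.sum_congr rfl fun c _ => Finset.sum_congr rfl fun b _ => ?_
    ring
  have eY : ∀ y, ∑ a, ∑ b, ∑ c, ∑ x, ∑ z, p (a, b, c, x, y, z) = ∑ c, pC c * g c y := by
    intro y
    simp only [hp, ← Finset.mul_sum, ← Finset.sum_mul, hpZ1, hpX1, mul_one, hg]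
    simp only [Finset.mul_sum, mul_assoc]
    simp only [← Finset.mul_sum, ← Finset.sum_mul, hpB1, one_mul]
    simp only [Finset.mul_sum]
    rw [Finset.sum_comm]
    refine Finset.sum_congr rfl fun c _ => Finset.sum_congr rfl fun b _ => ?_
    ring
  have eZ : ∀ z, ∑ a, ∑ b, ∑ c, ∑ x, ∑ y, p (a, b, c, x, y, z) = ∑ b, pB b * h b z := by
    intro z
    simp only [hp, ← Finset.mul_sum, ← Finset.sum_mul, hpY1, hpX1, hpC1, mul_one, hh]
    simp only [Finset.mul_sum]
    rw [Finset.sum_comm]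
    refine Finset.sum_congr rfl fun c _ => Finset.sum_congr rfl fun b _ => ?_
    ring
  simp only [eXY, eXZ, eX, eY, eZ]
  have r0 : ∀ c x y, 0 ≤ pC c * f c x * g c y := fun c x y =>
    mul_nonneg (mul_nonneg (hpC0 c) (f0 c x)) (g0 c y)
  have z0 : ∀ z, 0 ≤ ∑ b, pB b * h b z := fun z =>
    Finset.sum_nonneg fun b _ => mul_nonneg (hpB0 b) (h0 b z)
  have z1 : ∑ z, ∑ b, pB b * h b z = 1 := by
    rw [Finset.sum_comm]; simp only [← Finset.mul_sum, h1, mul_one, hpB1]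
  rw [tt_ent q hq (fun x => ∑ c, pC c * f c x) (fun x => Finset.sum_nonneg fun c _ => mul_nonneg (hpC0 c) (f0 c x)),
    tt_ent q hq (fun x => ∑ c, pC c * g c x) (fun x => Finset.sum_nonneg fun c _ => mul_nonneg (hpC0 c) (g0 c x)),
    tt_ent q hq (fun z => ∑ b, pB b * h b z) z0,
    tt_ent q hq (fun w : X × Y => ∑ c, pC c * f c w.1 * g c w.2) (fun w => Finset.sum_nonneg fun c _ => r0 c _ _),
    tt_ent q hq (fun w : X × Z => ∑ c, s c w.1 w.2) (fun w => Finset.sum_nonneg fun c _ => s0 c _ _)]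
  simp only [Fintype.sum_prod_type]
  -- (a)
  have ka := tt_ssa3 hq (fun y x c => pC c * f c x * g c y) (fun y x c => r0 c x y)
  have ea1 : ∀ y c, ∑ x, pC c * f c x * g c y = pC c * g c y := fun y c => by
    rw [← Finset.sum_mul, ← Finset.mul_sum, f1, mul_one]
  have ea2 : ∀ y, ∑ x, ∑ c, pC c * f c x * g c y = ∑ c, pC c * g c y := fun y => by
    rw [Finset.sum_comm]; simp only [ea1]
  simp only [ea1, ea2] at ka
  rw [Finset.sum_comm (s := (univ : Finset Y)) (t := (univ : Finset X)) (f := fun y x => (∑ c, pC c * f c x * g c y) ^ q),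
    Finset.sum_comm (s := (univ : Finset Y)) (t := (univ : Finset C))] at ka
  have ea3 : ∑ y, ∑ x, ∑ c, (pC c * f c x * g c y) ^ q = ∑ c, ∑ x, ∑ y, (pC c * f c x * g c y) ^ q := by
    calc _ = ∑ y, ∑ c, ∑ x, (pC c * f c x * g c y) ^ q :=
          Finset.sum_congr rfl fun y _ => Finset.sum_comm
      _ = ∑ c, ∑ y, ∑ x, (pC c * f c x * g c y) ^ q := Finset.sum_comm
      _ = _ := Finset.sum_congr rfl fun y _ => Finset.sum_comm
  rw [ea3] at ka
  -- (b)
  have kb := tt_ci hq pC hpC0 hpC1 f f0 f1 g g0 g1 dO hdO hX hY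
  -- (c)
  have kc := tt_ssa3 hq (fun x z c => s c x z) (fun x z c => s0 c x z)
  have ec2 : ∀ x, ∑ z, ∑ c, s c x z = ∑ c, pC c * f c x := fun x => by
    rw [Finset.sum_comm]; simp only [sz]
  simp only [sz, ec2] at kc
  rw [Finset.sum_comm (s := (univ : Finset X)) (t := (univ : Finset C))] at kc
  -- (d)
  have kd : ∑ x, ∑ z, ∑ c, s c x z ^ q ≤ (∑ c, pC c ^ q) * ∑ z, (∑ b, pB b * h b z) ^ q := by
    calc _ = ∑ z, ∑ x, ∑ c, s c x z ^ q := Finset.sum_comm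
      _ = ∑ z, ∑ c, ∑ x, s c x z ^ q := Finset.sum_congr rfl fun y _ => Finset.sum_comm
      _ = ∑ c, ∑ z, ∑ x, s c x z ^ q := Finset.sum_comm
      _ ≤ ∑ c, ∑ z, (pC c * ∑ b, pB b * h b z) ^ q := by
          refine Finset.sum_le_sum fun c _ => Finset.sum_le_sum fun z _ => ?_
          rw [← sx]
          exact tt_super hq (fun x => s c x z) (fun x => s0 c x z)
      _ = _ := by
          simp only [Real.mul_rpow (hpC0 _) (z0 _), Finset.sum_mul_sum]
  -- (e)
  have c_low := tt_low hq pC hpC0 hpC1 dU hdU hC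
  have c_up := tt_le_one hq pC hpC0 hpC1
  have z_low := tt_low hq _ z0 z1 dO hdO hZ
  have z_up := tt_le_one hq _ z0 z1
  have ke := mul_le_mul (sub_le_sub_left c_low 1) (sub_le_sub_left z_low 1) (by linarith) (by linarith)
  unfold B1
  have hq1 : 0 ≤ 1 / (q - 1) := by
    have : 0 < q - 1 := by linarith
    positivity
  generalize ∑ x, (∑ c, pC c * f c x) ^ q = TX at *
  generalize ∑ x, (∑ c, pC c * g c x) ^ q = TY at *
  generalize ∑ z, (∑ b, pB b * h b z) ^ q = TZ at *
  generalize ∑ x, ∑ y, (∑ c, pC c * f c x * g c y) ^ q = TXY at *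
  generalize ∑ x, ∑ z, (∑ c, s c x z) ^ q = TXZ at *
  generalize ∑ c, pC c ^ q = TC at *
  generalize (dO : ℝ) ^ (1 - q) = o at *
  generalize (dU : ℝ) ^ (1 - q) = u at *
  have key : 0 ≤ TX + TY + TZ - TXY - TXZ - 1 + (1 - o) * (2 - o - u) := by linarith
  have := mul_nonneg hq1 key
  linarith
end

section
/- Let p be a probability distribution on A × B × C × X × Y × Z compatible with the triangle causal structure, i.e. p(a,b,c,x,y,z) = p_A(a)·p_B(b)·p_C(c)·p_{X|BC}(x|b,c)·p_{Y|AC}(y|a,c)·p_{Z|AB}(z|a,b), where A, B, C each have cardinality d_u ≥ 2 and X, Y, Z each have cardinality d_o ≥ 2. Then for every real q > 1, −5S_q(X) − 5S_q(Y) − 5S_q(Z) + 4S_q(XY) + 4S_q(XZ) + 4S_q(YZ) − 2S_q(XYZ) ≥ max(B_{21}(q,d_o,d_u), B_{22}(q,d_o,d_u)), where B_{21}(q,d_o,d_u) = −(1/(q−1))·(11 + d_u^{3−3q} + 6d_o^{2−2q} + 3d_o^{1−q}d_u^{1−q} − 6d_u^{1−q} − 15d_o^{1−q}) and B_{22}(q,d_o,d_u)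 = −(1/(q−1))·(10 + d_o^{1−q}d_u^{3−3q} + 5d_o^{2−2q} + 2d_o^{1−q}d_u^{1−q} − 5d_u^{1−q} − 13d_o^{1−q}). -/
open Finset

/-- The bound `B_{21}(q,d_o,d_u)`. -/
noncomputable def B21 (q dO dU : ℝ) : ℝ :=
  -(1 / (q - 1)) * (11 + dU ^ (3 - 3 * q) + 6 * dO ^ (2 - 2 * q)
    + 3 * dO ^ (1 - q) * dU ^ (1 - q) - 6 * dU ^ (1 - q) - 15 * dO ^ (1 - q))

/-- The bound `B_{22}(q,d_o,d_u)`. -/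
noncomputable def B22 (q dO dU : ℝ) : ℝ :=
  -(1 / (q - 1)) * (10 + dO ^ (1 - q) * dU ^ (3 - 3 * q) + 5 * dO ^ (2 - 2 * q)
    + 2 * dO ^ (1 - q) * dU ^ (1 - q) - 5 * dU ^ (1 - q) - 13 * dO ^ (1 - q))


section TT
open Classical

noncomputable def ttPush {Ω α : Type*} [Fintype Ω] (p : Ω → ℝ) (π : Ω → α) (t : α) : ℝ :=
  ∑ ω, if π ω = t then p ω else 0

noncomputable def ttG {Ω α : Type*} [Fintype Ω] (q : ℝ) (p : Ω → ℝ) (π : Ω → α) : ℝ :=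
  ∑ ω, p ω * (ttPush p π (π ω)) ^ (q - 1)

lemma ttPush_nonneg {Ω α : Type*} [Fintype Ω] (p : Ω → ℝ) (hp : ∀ ω, 0 ≤ p ω) (π : Ω → α) (t : α) :
    0 ≤ ttPush p π t :=
  Finset.sum_nonneg fun ω _ => by split_ifs <;> simp [hp]

lemma ttG_eq {Ω α : Type*} [Fintype Ω] [Fintype α] (q : ℝ) (hq : 1 < q) (p : Ω → ℝ)
    (hp : ∀ ω, 0 ≤ p ω) (π : Ω → α) : ttG q p π = ∑ t, (ttPush p π t) ^ q := by
  have h1 : ∀ t, (ttPush p π t) ^ q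
      = ∑ ω, if π ω = t then p ω * (ttPush p π (π ω)) ^ (q - 1) else 0 := by
    intro t
    have : (ttPush p π t) ^ q = ttPush p π t * (ttPush p π t) ^ (q - 1) := by
      rw [← Real.rpow_one_add' (ttPush_nonneg p hp π t) (by linarith)]
      congr 1; ring
    rw [this]
    have e : ∀ c : ℝ, ttPush p π t * c = ∑ ω, (if π ω = t then p ω else 0) * c := by
      intro c; rw [ttPush, Finset.sum_mul]
    rw [e]
    refine Finset.sum_congr rfl fun ω _ => ?_
    split_ifs with h
    · rw [h]
    · simp
  simp_rw [h1]
  rw [Finset.sum_comm]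
  simp [ttG]

lemma ttG_congr {Ω α β : Type*} [Fintype Ω] (q : ℝ) (p : Ω → ℝ) (π : Ω → α) (σ : Ω → β)
    (h : ∀ ω ω', π ω = π ω' ↔ σ ω = σ ω') : ttG q p π = ttG q p σ := by
  simp only [ttG, ttPush, h]

lemma ttG_anti {Ω α β : Type*} [Fintype Ω] (q : ℝ) (hq : 1 < q) (p : Ω → ℝ)
    (hp : ∀ ω, 0 ≤ p ω) (π : Ω → α) (σ : Ω → β)
    (h : ∀ ω ω', π ω = π ω' → σ ω = σ ω') : ttG q p π ≤ ttG q p σ := by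
  refine Finset.sum_le_sum fun ω _ => mul_le_mul_of_nonneg_left ?_ (hp ω)
  refine Real.rpow_le_rpow (ttPush_nonneg p hp _ _) ?_ (by linarith)
  refine Finset.sum_le_sum fun ω' _ => ?_
  by_cases h1 : π ω' = π ω
  · rw [if_pos h1, if_pos (h _ _ h1)]
  · rw [if_neg h1]; split_ifs <;> simp [hp]

lemma tt_sub2 {α β : Type*} [Fintype α] [Fintype β] (q : ℝ) (hq : 1 < q) (f : α → β → ℝ)
    (hf : ∀ a b, 0 ≤ f a b) :
    ∑ a, (∑ b, f a b) ^ q + ∑ b, (∑ a, f a b) ^ q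
      ≤ ∑ a, ∑ b, (f a b) ^ q + (∑ a, ∑ b, f a b) ^ q := by
  set T := ∑ a, ∑ b, f a b with hT
  have hT0 : 0 ≤ T := Finset.sum_nonneg fun a _ => Finset.sum_nonneg fun b _ => hf a b
  have hq0 : q ≠ 0 := by linarith
  rcases hT0.eq_or_lt with h0 | hTpos
  · have hz : ∀ a b, f a b = 0 := by
      intro a b
      have h1 := (Finset.sum_eq_zero_iff_of_nonneg
        (fun a _ => Finset.sum_nonneg fun b _ => hf a b)).1 h0.symm a (Finset.mem_univ a)
      exact (Finset.sum_eq_zero_iff_of_nonneg (fun b _ => hf a b)).1 h1 b (Finset.mem_univ b)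
    simp [hz, Real.zero_rpow hq0, ← h0]
  set g : β → ℝ := fun b => ∑ a, f a b with hg
  have hg0 : ∀ b, 0 ≤ g b := fun b => Finset.sum_nonneg fun a _ => hf a b
  have hgT : ∑ b, g b = T := by rw [hT, Finset.sum_comm]
  have hgle : ∀ b, g b ≤ T := fun b => by
    rw [← hgT]; exact Finset.single_le_sum (fun b _ => hg0 b) (Finset.mem_univ b)
  have hfg : ∀ a b, f a b ≤ g b := fun a b =>
    Finset.single_le_sum (f := fun a => f a b) (fun a _ => hf a b) (Finset.mem_univ a)
  have hfy : ∀ a b, f a b = g b * (f a b / g b) := by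
    intro a b
    rcases (hg0 b).eq_or_lt with h | h
    · have := hfg a b
      rw [← h] at this ⊢
      have := hf a b
      simp; linarith
    · field_simp
  have hy0 : ∀ a b, 0 ≤ f a b / g b := fun a b => div_nonneg (hf a b) (hg0 b)
  have hTq : T ^ q = T ^ (q-1) * T := by
    rw [← Real.rpow_add_one hTpos.ne']; congr 1; ring
  have hb : ∀ b, (g b) ^ q - ∑ a, (f a b) ^ q
      ≤ T ^ (q-1) * g b - ∑ a, T ^ (q-1) * (g b * (f a b / g b) ^ q) := by
    intro b
    rcases (hg0 b).eq_or_lt with h | h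
    · have hz : ∀ a, f a b = 0 := fun a => le_antisymm ((hfg a b).trans h.symm.le) (hf a b)
      simp [hz, ← h, Real.zero_rpow hq0]
    · have e1 : ∀ a, (f a b) ^ q = (g b) ^ (q-1) * (g b * (f a b / g b) ^ q) := by
        intro a
        rw [← mul_assoc, ← Real.rpow_add_one h.ne', sub_add_cancel,
          ← Real.mul_rpow h.le (hy0 a b), ← hfy]
      have e2 : (g b) ^ q = (g b) ^ (q-1) * g b := by
        rw [← Real.rpow_add_one h.ne', sub_add_cancel]
      simp_rw [e1]
      have e3 : ∀ c : ℝ, c * g b - ∑ a, c * (g b * (f a b / g b) ^ q)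
          = c * (g b - ∑ a, g b * (f a b / g b) ^ q) := by
        intro c; rw [← Finset.mul_sum, mul_sub]
      rw [e2, e3, e3]
      refine mul_le_mul_of_nonneg_right (Real.rpow_le_rpow h.le (hgle b) (by linarith)) ?_
      rw [sub_nonneg]
      calc ∑ a, g b * (f a b / g b) ^ q ≤ ∑ a, g b * (f a b / g b) := by
            refine Finset.sum_le_sum fun a _ => mul_le_mul_of_nonneg_left ?_ h.le
            exact Real.rpow_le_self_of_le_one (hy0 a b) ((div_le_one h).2 (hfg a b)) hq.le
        _ = g b := by simp_rw [← hfy]; rfl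
  have ha : ∀ a, (∑ b, f a b) ^ q ≤ ∑ b, T ^ (q-1) * (g b * (f a b / g b) ^ q) := by
    intro a
    have J := Real.rpow_arith_mean_le_arith_mean_rpow Finset.univ (fun b => g b / T)
      (fun b => f a b / g b) (fun b _ => div_nonneg (hg0 b) hTpos.le)
      (by rw [← Finset.sum_div, hgT, div_self hTpos.ne']) (fun b _ => hy0 a b) hq.le
    have e : ∑ b, g b / T * (f a b / g b) = (∑ b, f a b) / T := by
      rw [Finset.sum_div]
      refine Finset.sum_congr rfl fun b _ => ?_
      conv_rhs => rw [hfy a b]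
      ring
    rw [e, Real.div_rpow (Finset.sum_nonneg fun b _ => hf a b) hTpos.le,
      div_le_iff₀ (Real.rpow_pos_of_pos hTpos q)] at J
    refine J.trans (le_of_eq ?_)
    rw [hTq, Finset.sum_mul]
    refine Finset.sum_congr rfl fun b _ => ?_
    field_simp
  have S1 := Finset.sum_le_sum fun b (_ : b ∈ Finset.univ) => hb b
  have S2 := Finset.sum_le_sum fun a (_ : a ∈ Finset.univ) => ha a
  rw [Finset.sum_sub_distrib, Finset.sum_sub_distrib, ← Finset.mul_sum, hgT, ← hTq,
    Finset.sum_comm (f := fun b a => f a b ^ q)] at S1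
  rw [Finset.sum_comm] at S2
  linarith

lemma tt_pull {α : Type*} [Fintype α] (P : Prop) {h : α → Decidable P} (f : α → ℝ) :
    (∑ x, @ite _ P (h x) (f x) 0) = if P then ∑ x, f x else 0 := by
  by_cases hP : P <;> simp [hP]

lemma ttPush_marg {Ω α β : Type*} [Fintype Ω] [Fintype α] (p : Ω → ℝ) (U : Ω → α) (V : Ω → β)
    (v : β) : ∑ u, ttPush p (fun ω => (U ω, V ω)) (u, v) = ttPush p V v := by
  simp only [ttPush]
  rw [Finset.sum_comm]
  refine Finset.sum_congr rfl fun ω _ => ?_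
  simp [ite_and]

lemma ttPush_marg2 {Ω α β γ : Type*} [Fintype Ω] [Fintype β] (p : Ω → ℝ)
    (U : Ω → α) (V : Ω → β) (W : Ω → γ) (u : α) (w : γ) :
    ∑ v, ttPush p (fun ω => (U ω, V ω, W ω)) (u, v, w) = ttPush p (fun ω => (U ω, W ω)) (u, w) := by
  simp only [ttPush]
  rw [Finset.sum_comm]
  refine Finset.sum_congr rfl fun ω _ => ?_
  simp only [Prod.mk.injEq, ite_and]
  by_cases h : U ω = u <;> simp [h]

lemma ttG_ssa {Ω α β γ : Type*} [Fintype Ω] [Fintype α] [Fintype β] [Fintype γ]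
    (q : ℝ) (hq : 1 < q) (p : Ω → ℝ) (hp : ∀ ω, 0 ≤ p ω) (U : Ω → α) (V : Ω → β) (W : Ω → γ) :
    ttG q p (fun ω => (U ω, W ω)) + ttG q p (fun ω => (V ω, W ω))
      ≤ ttG q p (fun ω => (U ω, V ω, W ω)) + ttG q p W := by
  rw [ttG_eq q hq p hp, ttG_eq q hq p hp, ttG_eq q hq p hp, ttG_eq q hq p hp]
  simp only [Fintype.sum_prod_type_right]
  rw [← Finset.sum_add_distrib, ← Finset.sum_add_distrib]
  refine Finset.sum_le_sum fun w _ => ?_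
  have H := tt_sub2 q hq (fun v u => ttPush p (fun ω => (U ω, V ω, W ω)) (u, v, w))
    (fun v u => ttPush_nonneg p hp _ _)
  have e1 : ∀ v, ∑ u, ttPush p (fun ω => (U ω, V ω, W ω)) (u, v, w)
      = ttPush p (fun ω => (V ω, W ω)) (v, w) := fun v =>
    ttPush_marg p U (fun ω => (V ω, W ω)) (v, w)
  simp only [e1, ttPush_marg2 p U V W, ttPush_marg p V W] at H
  linarith

lemma tt_pow_le_one {α : Type*} [Fintype α] (q : ℝ) (hq : 1 < q) (f : α → ℝ)
    (hf : ∀ a, 0 ≤ f a) (hs : ∑ a, f a = 1) : ∑ a, f a ^ q ≤ 1 := by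
  rw [← hs]
  refine Finset.sum_le_sum fun a _ => Real.rpow_le_self_of_le_one (hf a) ?_ hq.le
  rw [← hs]
  exact Finset.single_le_sum (fun a _ => hf a) (Finset.mem_univ a)

lemma tt_pow_ge {α : Type*} [Fintype α] (q : ℝ) (hq : 1 < q) (f : α → ℝ)
    (hf : ∀ a, 0 ≤ f a) (hs : ∑ a, f a = 1) :
    (Fintype.card α : ℝ) ^ (1 - q) ≤ ∑ a, f a ^ q := by
  have h := Real.rpow_sum_le_const_mul_sum_rpow (Finset.univ) f hq.le
  simp only [abs_of_nonneg (hf _)] at h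
  rw [hs, Real.one_rpow, Finset.card_univ] at h
  have hc : 0 < (Fintype.card α : ℝ) := by
    have : Nonempty α := by
      by_contra hn
      rw [not_nonempty_iff] at hn
      simp at hs
    exact_mod_cast Fintype.card_pos
  have e : (1 - q) = -(q - 1) := by ring
  rw [e, Real.rpow_neg hc.le, inv_le_iff_one_le_mul₀ (Real.rpow_pos_of_pos hc _), mul_comm]
  exact h

lemma ttG_ci {Ω α β γ : Type*} [Fintype Ω] [Fintype α] [Fintype β] [Fintype γ]
    (q : ℝ) (hq : 1 < q) (p : Ω → ℝ) (hp : ∀ ω, 0 ≤ p ω) (U : Ω → α) (V : Ω → β) (W : Ω → γ)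
    (r : γ → ℝ) (hr : ∀ w, 0 ≤ r w) (hr1 : ∑ w, r w = 1)
    (f : γ → α → ℝ) (hf : ∀ w u, 0 ≤ f w u) (hf1 : ∀ w, ∑ u, f w u = 1)
    (g : γ → β → ℝ) (hg : ∀ w v, 0 ≤ g w v) (hg1 : ∀ w, ∑ v, g w v = 1)
    (h : ∀ u v w, ttPush p (fun ω => (U ω, V ω, W ω)) (u, v, w) = r w * f w u * g w v) :
    ttG q p (fun ω => (U ω, V ω, W ω)) + ttG q p W
      - ttG q p (fun ω => (U ω, W ω)) - ttG q p (fun ω => (V ω, W ω))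
      ≤ (1 - (Fintype.card α : ℝ) ^ (1 - q)) * (1 - (Fintype.card β : ℝ) ^ (1 - q)) := by
  have h2 : ∀ v w, ttPush p (fun ω => (V ω, W ω)) (v, w) = r w * g w v := by
    intro v w
    rw [← ttPush_marg p U (fun ω => (V ω, W ω)) (v, w)]
    simp only [h]
    rw [← Finset.sum_mul, ← Finset.mul_sum, hf1, mul_one]
  have h1 : ∀ u w, ttPush p (fun ω => (U ω, W ω)) (u, w) = r w * f w u := by
    intro u w
    rw [← ttPush_marg2 p U V W u w]
    simp only [h]
    rw [← Finset.mul_sum, hg1, mul_one]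
  have h0 : ∀ w, ttPush p W w = r w := by
    intro w
    rw [← ttPush_marg p V W w]
    simp only [h2]
    rw [← Finset.mul_sum, hg1, mul_one]
  have hF := fun w => tt_pow_le_one q hq (f w) (hf w) (hf1 w)
  have hG := fun w => tt_pow_le_one q hq (g w) (hg w) (hg1 w)
  have hF' := fun w => tt_pow_ge q hq (f w) (hf w) (hf1 w)
  have hG' := fun w => tt_pow_ge q hq (g w) (hg w) (hg1 w)
  have hR := tt_pow_le_one q hq r hr hr1
  have hR0 : ∀ w, 0 ≤ r w ^ q := fun w => Real.rpow_nonneg (hr w) q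
  set ca := (Fintype.card α : ℝ) ^ (1 - q)
  set cb := (Fintype.card β : ℝ) ^ (1 - q)
  rw [ttG_eq q hq p hp, ttG_eq q hq p hp, ttG_eq q hq p hp, ttG_eq q hq p hp]
  simp only [Fintype.sum_prod_type_right, h, h0, h1, h2]
  have key : ∀ w, ∑ v, ∑ u, (r w * f w u * g w v) ^ q + r w ^ q - ∑ u, (r w * f w u) ^ q
      - ∑ v, (r w * g w v) ^ q = r w ^ q * ((1 - ∑ u, f w u ^ q) * (1 - ∑ v, g w v ^ q)) := by
    intro w
    have k1 : ∀ u v, (r w * f w u * g w v) ^ q = r w ^ q * (f w u ^ q * g w v ^ q) := by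
      intro u v
      rw [Real.mul_rpow (mul_nonneg (hr w) (hf w u)) (hg w v), Real.mul_rpow (hr w) (hf w u),
        mul_assoc]
    simp only [k1, Real.mul_rpow (hr w) (hf w _), Real.mul_rpow (hr w) (hg w _),
      ← Finset.mul_sum, ← Finset.sum_mul]
    ring
  rw [← Finset.sum_add_distrib, ← Finset.sum_sub_distrib, ← Finset.sum_sub_distrib]
  simp only [key]
  have hne : ∃ w : γ, True := by
    by_contra hn
    have : IsEmpty γ := ⟨fun w => hn ⟨w, trivial⟩⟩
    simp at hr1
  obtain ⟨w0, -⟩ := hne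
  have hca : 0 ≤ 1 - ca := by linarith [hF w0, hF' w0]
  have hcb : 0 ≤ 1 - cb := by linarith [hG w0, hG' w0]
  calc ∑ w, r w ^ q * ((1 - ∑ u, f w u ^ q) * (1 - ∑ v, g w v ^ q))
      ≤ ∑ w, r w ^ q * ((1 - ca) * (1 - cb)) := by
        refine Finset.sum_le_sum fun w _ => mul_le_mul_of_nonneg_left ?_ (hR0 w)
        refine mul_le_mul ?_ ?_ ?_ hca
        · linarith [hF' w]
        · linarith [hG' w]
        · linarith [hG w]
    _ = (∑ w, r w ^ q) * ((1 - ca) * (1 - cb)) := by rw [Finset.sum_mul]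
    _ ≤ 1 * ((1 - ca) * (1 - cb)) := mul_le_mul_of_nonneg_right hR (mul_nonneg hca hcb)
    _ = _ := one_mul _

noncomputable def ttE {Ω ι τ : Type*} [Fintype Ω] (q : ℝ) (p : Ω → ℝ) (v : ι → Ω → τ)
    (s : Finset ι) : ℝ := ttG q p (fun ω => fun i : s => v i ω)

lemma ttE_ker {Ω ι τ : Type*} (v : ι → Ω → τ) (s : Finset ι) (ω ω' : Ω) :
    ((fun i : s => v i ω) = (fun i : s => v i ω')) ↔ ∀ i ∈ s, v i ω = v i ω' := by
  simp [funext_iff]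

lemma ttE_sub {Ω ι τ : Type*} [Fintype Ω] [Fintype τ] [DecidableEq ι] (q : ℝ) (hq : 1 < q)
    (p : Ω → ℝ) (hp : ∀ ω, 0 ≤ p ω) (v : ι → Ω → τ)
    (s t u w : Finset ι) (hu : u = s ∪ t) (hw : w = s ∩ t) :
    ttE q p v s + ttE q p v t ≤ ttE q p v u + ttE q p v w := by
  have H := ttG_ssa q hq p hp (fun ω => fun i : s => v i ω) (fun ω => fun i : t => v i ω)
    (fun ω => fun i : w => v i ω)
  subst hu hw
  rw [ttG_congr q p (fun ω => (_, _)) (fun ω => fun i : s => v i ω),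
    ttG_congr q p (fun ω => ((fun i : t => v i ω), _)) (fun ω => fun i : t => v i ω),
    ttG_congr q p (fun ω => (_, _, _)) (fun ω => fun i : (s ∪ t : Finset ι) => v i ω)] at H
  · exact H
  all_goals
    intro ω ω'
    simp only [Prod.mk.injEq, ttE_ker, Finset.mem_union, Finset.mem_inter]
    grind

lemma ttE_anti {Ω ι τ : Type*} [Fintype Ω] (q : ℝ) (hq : 1 < q)
    (p : Ω → ℝ) (hp : ∀ ω, 0 ≤ p ω) (v : ι → Ω → τ)
    (s t : Finset ι) (h : s ⊆ t) : ttE q p v t ≤ ttE q p v s := by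
  refine ttG_anti q hq p hp _ _ fun ω ω' => ?_
  rw [ttE_ker, ttE_ker]
  exact fun H i hi => H i (h hi)

lemma ttE_eq {Ω ι τ α : Type*} [Fintype Ω] (q : ℝ) (p : Ω → ℝ) (v : ι → Ω → τ)
    (s : Finset ι) (π : Ω → α) (h : ∀ ω ω', π ω = π ω' ↔ ∀ i ∈ s, v i ω = v i ω') :
    ttG q p π = ttE q p v s :=
  ttG_congr q p _ _ fun ω ω' => by rw [ttE_ker, h]

lemma tt_tsallis {Ω α : Type*} [Fintype Ω] [Fintype α] (q : ℝ) (hq : 1 < q) (p : Ω → ℝ)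
    (hp : ∀ ω, 0 ≤ p ω) (π : Ω → α) (f : α → ℝ) (hf : ∀ t, f t = ttPush p π t) :
    tsallisEnt q f = (1 / (q - 1)) * (1 - ttG q p π) := by
  have hff : f = ttPush p π := funext hf
  have e : ∑ x ∈ univ.filter (fun x => 0 < f x), f x ^ q = ttG q p π := by
    rw [ttG_eq q hq p hp, hff]
    refine Finset.sum_subset (Finset.filter_subset _ _) fun x _ hx => ?_
    have h1 := ttPush_nonneg p hp π x
    have h2 : ttPush p π x = 0 := by
      simp at hx; linarith
    rw [h2, Real.zero_rpow (by linarith)]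
  unfold tsallisEnt
  have : (univ.filter (fun x => 0 < f x)) = univ.filter (fun x => 0 < f x) := rfl
  rw [← e]
  have h1 : (1 - q) ≠ 0 := by linarith
  have h2 : (q - 1) ≠ 0 := by linarith
  have h3 : 1 / (1 - q) = - (1 / (q - 1)) := by
    rw [← neg_sub q 1, one_div, inv_neg, one_div]
  rw [h3]
  have h4 : ∀ a b : ℝ, a = b → -(1 / (q - 1)) * (a - 1) = 1 / (q - 1) * (1 - b) := by
    rintro a b rfl; ring
  apply h4
  congr!

end TT
set_option maxHeartbeats 4000000 in
/-- For any distribution compatible with the triangle causal structure, with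
unobserved nodes of cardinality `d_u ≥ 2` and observed nodes of cardinality
`d_o ≥ 2`, and any `q > 1`:
`−5S_q(X) − 5S_q(Y) − 5S_q(Z) + 4S_q(XY) + 4S_q(XZ) + 4S_q(YZ) − 2S_q(XYZ)
  ≥ max(B_{21}(q,d_o,d_u), B_{22}(q,d_o,d_u))`. -/
theorem triangle_tsallis_ineq_two
    {A B C X Y Z : Type*} [Fintype A] [Fintype B] [Fintype C]
    [Fintype X] [Fintype Y] [Fintype Z]
    (dU dO : ℕ) (hdU : 2 ≤ dU) (hdO : 2 ≤ dO)
    (hA : Fintype.card A = dU) (hB : Fintype.card B = dU) (hC : Fintype.card C = dU)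
    (hX : Fintype.card X = dO) (hY : Fintype.card Y = dO) (hZ : Fintype.card Z = dO)
    (pA : A → ℝ) (hpA0 : ∀ a, 0 ≤ pA a) (hpA1 : ∑ a, pA a = 1)
    (pB : B → ℝ) (hpB0 : ∀ b, 0 ≤ pB b) (hpB1 : ∑ b, pB b = 1)
    (pC : C → ℝ) (hpC0 : ∀ c, 0 ≤ pC c) (hpC1 : ∑ c, pC c = 1)
    (pX : B → C → X → ℝ) (hpX0 : ∀ b c x, 0 ≤ pX b c x) (hpX1 : ∀ b c, ∑ x, pX b c x = 1)
    (pY : A → C → Y → ℝ) (hpY0 : ∀ a c y, 0 ≤ pY a c y) (hpY1 : ∀ a c, ∑ y, pY a c y = 1)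
    (pZ : A → B → Z → ℝ) (hpZ0 : ∀ a b z, 0 ≤ pZ a b z) (hpZ1 : ∀ a b, ∑ z, pZ a b z = 1)
    (p : A × B × C × X × Y × Z → ℝ)
    (hp : ∀ a b c x y z, p (a, b, c, x, y, z)
      = pA a * pB b * pC c * pX b c x * pY a c y * pZ a b z)
    (q : ℝ) (hq : 1 < q) :
    - 5 * tsallisEnt q (fun x => ∑ a, ∑ b, ∑ c, ∑ y, ∑ z, p (a, b, c, x, y, z))
      - 5 * tsallisEnt q (fun y => ∑ a, ∑ b, ∑ c, ∑ x, ∑ z, p (a, b, c, x, y, z))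
      - 5 * tsallisEnt q (fun z => ∑ a, ∑ b, ∑ c, ∑ x, ∑ y, p (a, b, c, x, y, z))
      + 4 * tsallisEnt q (fun w : X × Y => ∑ a, ∑ b, ∑ c, ∑ z, p (a, b, c, w.1, w.2, z))
      + 4 * tsallisEnt q (fun w : X × Z => ∑ a, ∑ b, ∑ c, ∑ y, p (a, b, c, w.1, y, w.2))
      + 4 * tsallisEnt q (fun w : Y × Z => ∑ a, ∑ b, ∑ c, ∑ x, p (a, b, c, x, w.1, w.2))
      - 2 * tsallisEnt q (fun w : X × Y × Z => ∑ a, ∑ b, ∑ c, p (a, b, c, w.1, w.2.1, w.2.2))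
      ≥ max (B21 q dO dU) (B22 q dO dU) := by
  classical
  have hp0 : ∀ ω, 0 ≤ p ω := by
    rintro ⟨a, b, c, x, y, z⟩
    rw [hp]
    have := hpA0 a; have := hpB0 b; have := hpC0 c
    have := hpX0 b c x; have := hpY0 a c y; have := hpZ0 a b z
    positivity
  obtain ⟨v, hv⟩ : ∃ v : Fin 6 → (A × B × C × X × Y × Z) → (A ⊕ B ⊕ C ⊕ X ⊕ Y ⊕ Z), v =
    fun i ω => ![Sum.inl ω.1, Sum.inr (Sum.inl ω.2.1), Sum.inr (Sum.inr (Sum.inl ω.2.2.1)),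
      Sum.inr (Sum.inr (Sum.inr (Sum.inl ω.2.2.2.1))),
      Sum.inr (Sum.inr (Sum.inr (Sum.inr (Sum.inl ω.2.2.2.2.1)))),
      Sum.inr (Sum.inr (Sum.inr (Sum.inr (Sum.inr ω.2.2.2.2.2))))] i := ⟨_, rfl⟩
  have k0 : ∀ ω ω', v 0 ω = v 0 ω' ↔ ω.1 = ω'.1 := by intro ω ω'; simp [hv]
  have k1 : ∀ ω ω', v 1 ω = v 1 ω' ↔ ω.2.1 = ω'.2.1 := by intro ω ω'; simp [hv]
  have k2 : ∀ ω ω', v 2 ω = v 2 ω' ↔ ω.2.2.1 = ω'.2.2.1 := by intro ω ω'; simp [hv]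
  have k3 : ∀ ω ω', v 3 ω = v 3 ω' ↔ ω.2.2.2.1 = ω'.2.2.2.1 := by intro ω ω'; simp [hv]
  have k4 : ∀ ω ω', v 4 ω = v 4 ω' ↔ ω.2.2.2.2.1 = ω'.2.2.2.2.1 := by intro ω ω'; simp [hv]
  have k5 : ∀ ω ω', v 5 ω = v 5 ω' ↔ ω.2.2.2.2.2 = ω'.2.2.2.2.2 := by intro ω ω'; simp [hv]
  clear hv
  have k := And.intro k0 (And.intro k1 (And.intro k2 (And.intro k3 (And.intro k4 k5))))
  have n1 := And.intro hpA1 (And.intro hpB1 (And.intro hpC1 (And.intro hpX1 (And.intro hpY1 hpZ1))))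
  obtain ⟨E, hE⟩ : ∃ E : Finset (Fin 6) → ℝ, E = ttE q p v := ⟨_, rfl⟩
  have sub : ∀ s t u w : Finset (Fin 6), u = s ∪ t → w = s ∩ t → E s + E t ≤ E u + E w := by
    rw [hE]; exact ttE_sub q hq p hp0 v
  have anti : ∀ s t : Finset (Fin 6), s ⊆ t → E t ≤ E s := by
    rw [hE]; exact ttE_anti q hq p hp0 v
  have tot : ∑ ω, p ω = 1 := by
    simp only [Fintype.sum_prod_type, hp, ← Finset.mul_sum, n1, mul_one, hpA1, hpB1,
      hpC1]
  have E0 : E ∅ = 1 := by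
    rw [hE, ← ttE_eq q p v ∅ (fun _ => ()) (by simp)]
    simp [ttG, ttPush, tot]
  have u0 : (Fintype.card A : ℝ) = dU := by rw [hA]
  have TX : tsallisEnt q (fun x => ∑ a, ∑ b, ∑ c, ∑ y, ∑ z, p (a, b, c, x, y, z)) = (1 / (q - 1)) * (1 - E {3}) := by
    rw [hE, ← ttE_eq q p v {3} (fun ω => ω.2.2.2.1) (by intro ω ω'; simp [k, Prod.ext_iff, and_assoc]; try tauto)]
    apply tt_tsallis q hq p hp0
    intro t
    simp [ttPush, Fintype.sum_prod_type, Prod.ext_iff, ite_and, tt_pull]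
  have TY : tsallisEnt q (fun y => ∑ a, ∑ b, ∑ c, ∑ x, ∑ z, p (a, b, c, x, y, z)) = (1 / (q - 1)) * (1 - E {4}) := by
    rw [hE, ← ttE_eq q p v {4} (fun ω => ω.2.2.2.2.1) (by intro ω ω'; simp [k, Prod.ext_iff, and_assoc]; try tauto)]
    apply tt_tsallis q hq p hp0
    intro t
    simp [ttPush, Fintype.sum_prod_type, Prod.ext_iff, ite_and, tt_pull]
  have TZ : tsallisEnt q (fun z => ∑ a, ∑ b, ∑ c, ∑ x, ∑ y, p (a, b, c, x, y, z)) = (1 / (q - 1)) * (1 - E {5}) := by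
    rw [hE, ← ttE_eq q p v {5} (fun ω => ω.2.2.2.2.2) (by intro ω ω'; simp [k, Prod.ext_iff, and_assoc]; try tauto)]
    apply tt_tsallis q hq p hp0
    intro t
    simp [ttPush, Fintype.sum_prod_type, Prod.ext_iff, ite_and, tt_pull]
  have TXY : tsallisEnt q (fun w : X × Y => ∑ a, ∑ b, ∑ c, ∑ z, p (a, b, c, w.1, w.2, z)) = (1 / (q - 1)) * (1 - E {3, 4}) := by
    rw [hE, ← ttE_eq q p v {3, 4} (fun ω => (ω.2.2.2.1, ω.2.2.2.2.1)) (by intro ω ω'; simp [k, Prod.ext_iff, and_assoc]; try tauto)]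
    apply tt_tsallis q hq p hp0
    intro t
    simp [ttPush, Fintype.sum_prod_type, Prod.ext_iff, ite_and, tt_pull]
  have TXZ : tsallisEnt q (fun w : X × Z => ∑ a, ∑ b, ∑ c, ∑ y, p (a, b, c, w.1, y, w.2)) = (1 / (q - 1)) * (1 - E {3, 5}) := by
    rw [hE, ← ttE_eq q p v {3, 5} (fun ω => (ω.2.2.2.1, ω.2.2.2.2.2)) (by intro ω ω'; simp [k, Prod.ext_iff, and_assoc]; try tauto)]
    apply tt_tsallis q hq p hp0
    intro t
    simp [ttPush, Fintype.sum_prod_type, Prod.ext_iff, ite_and, tt_pull]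
  have TYZ : tsallisEnt q (fun w : Y × Z => ∑ a, ∑ b, ∑ c, ∑ x, p (a, b, c, x, w.1, w.2)) = (1 / (q - 1)) * (1 - E {4, 5}) := by
    rw [hE, ← ttE_eq q p v {4, 5} (fun ω => (ω.2.2.2.2.1, ω.2.2.2.2.2)) (by intro ω ω'; simp [k, Prod.ext_iff, and_assoc]; try tauto)]
    apply tt_tsallis q hq p hp0
    intro t
    simp [ttPush, Fintype.sum_prod_type, Prod.ext_iff, ite_and, tt_pull]
  have TXYZ : tsallisEnt q (fun w : X × Y × Z => ∑ a, ∑ b, ∑ c, p (a, b, c, w.1, w.2.1, w.2.2)) = (1 / (q - 1)) * (1 - E {3, 4, 5}) := by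
    rw [hE, ← ttE_eq q p v {3, 4, 5} (fun ω => (ω.2.2.2.1, ω.2.2.2.2.1, ω.2.2.2.2.2)) (by intro ω ω'; simp [k, Prod.ext_iff, and_assoc]; try tauto)]
    apply tt_tsallis q hq p hp0
    intro t
    simp [ttPush, Fintype.sum_prod_type, Prod.ext_iff, ite_and, tt_pull]
  have ci_X_Y_C : E {2, 3, 4} + E {2} - E {2, 3} - E {2, 4} ≤ (1 - (Fintype.card (X) : ℝ) ^ (1 - q)) * (1 - (Fintype.card (Y) : ℝ) ^ (1 - q)) := by
    rw [hE, ← ttE_eq q p v {2, 3, 4} (fun ω => (ω.2.2.2.1, ω.2.2.2.2.1, ω.2.2.1)) ,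
      ← ttE_eq q p v {2} (fun ω => ω.2.2.1) ,
      ← ttE_eq q p v {2, 3} (fun ω => (ω.2.2.2.1, ω.2.2.1)) ,
      ← ttE_eq q p v {2, 4} (fun ω => (ω.2.2.2.2.1, ω.2.2.1)) ]
    rotate_left
    iterate 4 focus (intro ω ω'; simp [k, Prod.ext_iff, and_assoc]; try tauto)
    refine ttG_ci q hq p hp0 (fun ω => ω.2.2.2.1) (fun ω => ω.2.2.2.2.1) (fun ω => ω.2.2.1)
      (pC) ?_ ?_ (fun c x => ∑ b, pB b * pX b c x) ?_ ?_ (fun c y => ∑ a, pA a * pY a c y) ?_ ?_ ?_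
    · exact hpC0
    · exact hpC1
    · intros
      (repeat' first | (refine Finset.sum_nonneg fun _ _ => ?_) | (refine mul_nonneg ?_ ?_)) <;> simp [*]
    · intros
      rw [Finset.sum_comm]; simp only [← Finset.mul_sum, n1, mul_one]
    · intros
      (repeat' first | (refine Finset.sum_nonneg fun _ _ => ?_) | (refine mul_nonneg ?_ ?_)) <;> simp [*]
    · intros
      rw [Finset.sum_comm]; simp only [← Finset.mul_sum, n1, mul_one]
    · rintro x y c
      simp only [ttPush, Fintype.sum_prod_type, Prod.mk.injEq, and_assoc, and_true]
      simp only [ite_and, tt_pull, Finset.sum_ite_eq', Finset.mem_univ, if_true, hp, ← Finset.mul_sum, n1, mul_one]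
      simp only [← Finset.sum_mul, ← Finset.mul_sum, n1, mul_one, one_mul]
      simp only [Finset.sum_mul, Finset.mul_sum]
      exact Finset.sum_congr rfl fun _ _ => Finset.sum_congr rfl fun _ _ => by ring1
  have ci_X_Z_B : E {1, 3, 5} + E {1} - E {1, 3} - E {1, 5} ≤ (1 - (Fintype.card (X) : ℝ) ^ (1 - q)) * (1 - (Fintype.card (Z) : ℝ) ^ (1 - q)) := by
    rw [hE, ← ttE_eq q p v {1, 3, 5} (fun ω => (ω.2.2.2.1, ω.2.2.2.2.2, ω.2.1)) ,
      ← ttE_eq q p v {1} (fun ω => ω.2.1) ,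
      ← ttE_eq q p v {1, 3} (fun ω => (ω.2.2.2.1, ω.2.1)) ,
      ← ttE_eq q p v {1, 5} (fun ω => (ω.2.2.2.2.2, ω.2.1)) ]
    rotate_left
    iterate 4 focus (intro ω ω'; simp [k, Prod.ext_iff, and_assoc]; try tauto)
    refine ttG_ci q hq p hp0 (fun ω => ω.2.2.2.1) (fun ω => ω.2.2.2.2.2) (fun ω => ω.2.1)
      (pB) ?_ ?_ (fun b x => ∑ c, pC c * pX b c x) ?_ ?_ (fun b z => ∑ a, pA a * pZ a b z) ?_ ?_ ?_
    · exact hpB0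
    · exact hpB1
    · intros
      (repeat' first | (refine Finset.sum_nonneg fun _ _ => ?_) | (refine mul_nonneg ?_ ?_)) <;> simp [*]
    · intros
      rw [Finset.sum_comm]; simp only [← Finset.mul_sum, n1, mul_one]
    · intros
      (repeat' first | (refine Finset.sum_nonneg fun _ _ => ?_) | (refine mul_nonneg ?_ ?_)) <;> simp [*]
    · intros
      rw [Finset.sum_comm]; simp only [← Finset.mul_sum, n1, mul_one]
    · rintro x z b
      simp only [ttPush, Fintype.sum_prod_type, Prod.mk.injEq, and_assoc, and_true]
      simp only [ite_and, tt_pull, Finset.sum_ite_eq', Finset.mem_univ, if_true, hp, ← Finset.mul_sum, n1, mul_one]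
      simp only [← Finset.sum_mul, ← Finset.mul_sum, n1, mul_one, one_mul]
      simp only [Finset.sum_mul, Finset.mul_sum]
      exact Finset.sum_congr rfl fun _ _ => Finset.sum_congr rfl fun _ _ => by ring1
  have ci_Y_Z_A : E {0, 4, 5} + E {0} - E {0, 4} - E {0, 5} ≤ (1 - (Fintype.card (Y) : ℝ) ^ (1 - q)) * (1 - (Fintype.card (Z) : ℝ) ^ (1 - q)) := by
    rw [hE, ← ttE_eq q p v {0, 4, 5} (fun ω => (ω.2.2.2.2.1, ω.2.2.2.2.2, ω.1)) ,
      ← ttE_eq q p v {0} (fun ω => ω.1) ,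
      ← ttE_eq q p v {0, 4} (fun ω => (ω.2.2.2.2.1, ω.1)) ,
      ← ttE_eq q p v {0, 5} (fun ω => (ω.2.2.2.2.2, ω.1)) ]
    rotate_left
    iterate 4 focus (intro ω ω'; simp [k, Prod.ext_iff, and_assoc]; try tauto)
    refine ttG_ci q hq p hp0 (fun ω => ω.2.2.2.2.1) (fun ω => ω.2.2.2.2.2) (fun ω => ω.1)
      (pA) ?_ ?_ (fun a y => ∑ c, pC c * pY a c y) ?_ ?_ (fun a z => ∑ b, pB b * pZ a b z) ?_ ?_ ?_
    · exact hpA0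
    · exact hpA1
    · intros
      (repeat' first | (refine Finset.sum_nonneg fun _ _ => ?_) | (refine mul_nonneg ?_ ?_)) <;> simp [*]
    · intros
      rw [Finset.sum_comm]; simp only [← Finset.mul_sum, n1, mul_one]
    · intros
      (repeat' first | (refine Finset.sum_nonneg fun _ _ => ?_) | (refine mul_nonneg ?_ ?_)) <;> simp [*]
    · intros
      rw [Finset.sum_comm]; simp only [← Finset.mul_sum, n1, mul_one]
    · rintro y z a
      simp only [ttPush, Fintype.sum_prod_type, Prod.mk.injEq, and_assoc, and_true]
      simp only [ite_and, tt_pull, Finset.sum_ite_eq', Finset.mem_univ, if_true, hp, ← Finset.mul_sum, n1, mul_one]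
      simp only [← Finset.sum_mul, ← Finset.mul_sum, n1, mul_one, one_mul]
      simp only [Finset.sum_mul, Finset.mul_sum]
      exact Finset.sum_congr rfl fun _ _ => Finset.sum_congr rfl fun _ _ => by ring1
  have ci_A_X_ : E {0, 3} + E ∅ - E {0} - E {3} ≤ (1 - (Fintype.card (A) : ℝ) ^ (1 - q)) * (1 - (Fintype.card (X) : ℝ) ^ (1 - q)) := by
    rw [hE, ← ttE_eq q p v {0, 3} (fun ω => (ω.1, ω.2.2.2.1, ())) ,
      ← ttE_eq q p v ∅ (fun _ => ()) ,
      ← ttE_eq q p v {0} (fun ω => (ω.1, ())) ,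
      ← ttE_eq q p v {3} (fun ω => (ω.2.2.2.1, ())) ]
    rotate_left
    iterate 4 focus (intro ω ω'; simp [k, Prod.ext_iff, and_assoc]; try tauto)
    refine ttG_ci q hq p hp0 (fun ω => ω.1) (fun ω => ω.2.2.2.1) (fun _ => ())
      (fun _ => 1) ?_ ?_ (fun _ => pA) ?_ ?_ (fun _ x => ∑ b, ∑ c, pB b * (pC c * pX b c x)) ?_ ?_ ?_
    · simp
    · simp
    · exact fun _ => hpA0
    · exact fun _ => hpA1
    · intros
      (repeat' first | (refine Finset.sum_nonneg fun _ _ => ?_) | (refine mul_nonneg ?_ ?_)) <;> simp [*]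
    · intros
      rw [Finset.sum_comm]; refine Eq.trans (Finset.sum_congr rfl fun _ _ => Finset.sum_comm) ?_; simp only [← Finset.mul_sum, n1, mul_one]
    · rintro a x u
      simp only [ttPush, Fintype.sum_prod_type, Prod.mk.injEq, and_assoc, and_true]
      simp only [ite_and, tt_pull, Finset.sum_ite_eq', Finset.mem_univ, if_true, hp, ← Finset.mul_sum, n1, mul_one]
      simp only [← Finset.sum_mul, ← Finset.mul_sum, n1, mul_one, one_mul]
      simp only [Finset.sum_mul, Finset.mul_sum]
      exact Finset.sum_congr rfl fun _ _ => Finset.sum_congr rfl fun _ _ => by ring1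
  have ci_B_Y_ : E {1, 4} + E ∅ - E {1} - E {4} ≤ (1 - (Fintype.card (B) : ℝ) ^ (1 - q)) * (1 - (Fintype.card (Y) : ℝ) ^ (1 - q)) := by
    rw [hE, ← ttE_eq q p v {1, 4} (fun ω => (ω.2.1, ω.2.2.2.2.1, ())) ,
      ← ttE_eq q p v ∅ (fun _ => ()) ,
      ← ttE_eq q p v {1} (fun ω => (ω.2.1, ())) ,
      ← ttE_eq q p v {4} (fun ω => (ω.2.2.2.2.1, ())) ]
    rotate_left
    iterate 4 focus (intro ω ω'; simp [k, Prod.ext_iff, and_assoc]; try tauto)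
    refine ttG_ci q hq p hp0 (fun ω => ω.2.1) (fun ω => ω.2.2.2.2.1) (fun _ => ())
      (fun _ => 1) ?_ ?_ (fun _ => pB) ?_ ?_ (fun _ y => ∑ a, ∑ c, pA a * (pC c * pY a c y)) ?_ ?_ ?_
    · simp
    · simp
    · exact fun _ => hpB0
    · exact fun _ => hpB1
    · intros
      (repeat' first | (refine Finset.sum_nonneg fun _ _ => ?_) | (refine mul_nonneg ?_ ?_)) <;> simp [*]
    · intros
      rw [Finset.sum_comm]; refine Eq.trans (Finset.sum_congr rfl fun _ _ => Finset.sum_comm) ?_; simp only [← Finset.mul_sum, n1, mul_one]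
    · rintro b y u
      simp only [ttPush, Fintype.sum_prod_type, Prod.mk.injEq, and_assoc, and_true]
      simp only [ite_and, tt_pull, Finset.sum_ite_eq', Finset.mem_univ, if_true, hp, ← Finset.mul_sum, n1, mul_one]
      simp only [← Finset.sum_mul, ← Finset.mul_sum, n1, mul_one, one_mul]
      simp only [Finset.sum_mul, Finset.mul_sum]
      exact Finset.sum_congr rfl fun _ _ => Finset.sum_congr rfl fun _ _ => by ring1
  have ci_C_Z_ : E {2, 5} + E ∅ - E {2} - E {5} ≤ (1 - (Fintype.card (C) : ℝ) ^ (1 - q)) * (1 - (Fintype.card (Z) : ℝ) ^ (1 - q)) := by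
    rw [hE, ← ttE_eq q p v {2, 5} (fun ω => (ω.2.2.1, ω.2.2.2.2.2, ())) ,
      ← ttE_eq q p v ∅ (fun _ => ()) ,
      ← ttE_eq q p v {2} (fun ω => (ω.2.2.1, ())) ,
      ← ttE_eq q p v {5} (fun ω => (ω.2.2.2.2.2, ())) ]
    rotate_left
    iterate 4 focus (intro ω ω'; simp [k, Prod.ext_iff, and_assoc]; try tauto)
    refine ttG_ci q hq p hp0 (fun ω => ω.2.2.1) (fun ω => ω.2.2.2.2.2) (fun _ => ())
      (fun _ => 1) ?_ ?_ (fun _ => pC) ?_ ?_ (fun _ z => ∑ a, ∑ b, pA a * (pB b * pZ a b z)) ?_ ?_ ?_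
    · simp
    · simp
    · exact fun _ => hpC0
    · exact fun _ => hpC1
    · intros
      (repeat' first | (refine Finset.sum_nonneg fun _ _ => ?_) | (refine mul_nonneg ?_ ?_)) <;> simp [*]
    · intros
      rw [Finset.sum_comm]; refine Eq.trans (Finset.sum_congr rfl fun _ _ => Finset.sum_comm) ?_; simp only [← Finset.mul_sum, n1, mul_one]
    · rintro c z u
      simp only [ttPush, Fintype.sum_prod_type, Prod.mk.injEq, and_assoc, and_true]
      simp only [ite_and, tt_pull, Finset.sum_ite_eq', Finset.mem_univ, if_true, hp, ← Finset.mul_sum, n1, mul_one]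
      simp only [← Finset.sum_mul, ← Finset.mul_sum, n1, mul_one, one_mul]
      simp only [Finset.sum_mul, Finset.mul_sum]
      exact Finset.sum_congr rfl fun _ _ => Finset.sum_congr rfl fun _ _ => by ring1
  have ci_A_B_ : E {0, 1} + E ∅ - E {0} - E {1} ≤ (1 - (Fintype.card (A) : ℝ) ^ (1 - q)) * (1 - (Fintype.card (B) : ℝ) ^ (1 - q)) := by
    rw [hE, ← ttE_eq q p v {0, 1} (fun ω => (ω.1, ω.2.1, ())) ,
      ← ttE_eq q p v ∅ (fun _ => ()) ,
      ← ttE_eq q p v {0} (fun ω => (ω.1, ())) ,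
      ← ttE_eq q p v {1} (fun ω => (ω.2.1, ())) ]
    rotate_left
    iterate 4 focus (intro ω ω'; simp [k, Prod.ext_iff, and_assoc]; try tauto)
    refine ttG_ci q hq p hp0 (fun ω => ω.1) (fun ω => ω.2.1) (fun _ => ())
      (fun _ => 1) ?_ ?_ (fun _ => pA) ?_ ?_ (fun _ => pB) ?_ ?_ ?_
    · simp
    · simp
    · exact fun _ => hpA0
    · exact fun _ => hpA1
    · exact fun _ => hpB0
    · exact fun _ => hpB1
    · rintro a b u
      simp only [ttPush, Fintype.sum_prod_type, Prod.mk.injEq, and_assoc, and_true]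
      simp only [ite_and, tt_pull, Finset.sum_ite_eq', Finset.mem_univ, if_true, hp, ← Finset.mul_sum, n1, mul_one]
      simp [n1, ← Finset.sum_mul]
  have ci_AB_C_ : E {0, 1, 2} + E ∅ - E {0, 1} - E {2} ≤ (1 - (Fintype.card (A × B) : ℝ) ^ (1 - q)) * (1 - (Fintype.card (C) : ℝ) ^ (1 - q)) := by
    rw [hE, ← ttE_eq q p v {0, 1, 2} (fun ω => ((ω.1, ω.2.1), ω.2.2.1, ())) ,
      ← ttE_eq q p v ∅ (fun _ => ()) ,
      ← ttE_eq q p v {0, 1} (fun ω => ((ω.1, ω.2.1), ())) ,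
      ← ttE_eq q p v {2} (fun ω => (ω.2.2.1, ())) ]
    rotate_left
    iterate 4 focus (intro ω ω'; simp [k, Prod.ext_iff, and_assoc]; try tauto)
    refine ttG_ci q hq p hp0 (fun ω => (ω.1, ω.2.1)) (fun ω => ω.2.2.1) (fun _ => ())
      (fun _ => 1) ?_ ?_ (fun _ t => pA t.1 * pB t.2) ?_ ?_ (fun _ => pC) ?_ ?_ ?_
    · simp
    · simp
    · exact fun _ _ => mul_nonneg (hpA0 _) (hpB0 _)
    · simp [Fintype.sum_prod_type, ← Finset.mul_sum, n1]
    · exact fun _ => hpC0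
    · exact fun _ => hpC1
    · rintro ⟨a, b⟩ c u
      simp only [ttPush, Fintype.sum_prod_type, Prod.mk.injEq, and_assoc, and_true]
      simp only [ite_and, tt_pull, Finset.sum_ite_eq', Finset.mem_univ, if_true, hp, ← Finset.mul_sum, n1, mul_one]
      simp [n1, ← Finset.sum_mul]
  have ci_B_AY_ : E {0, 1, 4} + E ∅ - E {1} - E {0, 4} ≤ (1 - (Fintype.card (B) : ℝ) ^ (1 - q)) * (1 - (Fintype.card (A × Y) : ℝ) ^ (1 - q)) := by
    rw [hE, ← ttE_eq q p v {0, 1, 4} (fun ω => (ω.2.1, (ω.1, ω.2.2.2.2.1), ())) ,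
      ← ttE_eq q p v ∅ (fun _ => ()) ,
      ← ttE_eq q p v {1} (fun ω => (ω.2.1, ())) ,
      ← ttE_eq q p v {0, 4} (fun ω => ((ω.1, ω.2.2.2.2.1), ())) ]
    rotate_left
    iterate 4 focus (intro ω ω'; simp [k, Prod.ext_iff, and_assoc]; try tauto)
    refine ttG_ci q hq p hp0 (fun ω => ω.2.1) (fun ω => (ω.1, ω.2.2.2.2.1)) (fun _ => ())
      (fun _ => 1) ?_ ?_ (fun _ => pB) ?_ ?_ (fun _ t => pA t.1 * ∑ c, pC c * pY t.1 c t.2) ?_ ?_ ?_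
    · simp
    · simp
    · exact fun _ => hpB0
    · exact fun _ => hpB1
    · intros
      (repeat' first | (refine Finset.sum_nonneg fun _ _ => ?_) | (refine mul_nonneg ?_ ?_)) <;> simp [*]
    · intros
      simp only [Fintype.sum_prod_type, ← Finset.mul_sum]; refine Eq.trans (Finset.sum_congr rfl fun _ _ => by rw [Finset.sum_comm]) ?_; simp only [← Finset.mul_sum, n1, mul_one]
    · rintro b ⟨a, y⟩ u
      simp only [ttPush, Fintype.sum_prod_type, Prod.mk.injEq, and_assoc, and_true]
      simp only [ite_and, tt_pull, Finset.sum_ite_eq', Finset.mem_univ, if_true, hp, ← Finset.mul_sum, n1, mul_one]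
      simp only [← Finset.sum_mul, ← Finset.mul_sum, n1, mul_one, one_mul]
      simp only [Finset.sum_mul, Finset.mul_sum]
      exact Finset.sum_congr rfl fun _ _ => by ring1
  have ci_C_ABZ_ : E {0, 1, 2, 5} + E ∅ - E {2} - E {0, 1, 5} ≤ (1 - (Fintype.card (C) : ℝ) ^ (1 - q)) * (1 - (Fintype.card (A × B × Z) : ℝ) ^ (1 - q)) := by
    rw [hE, ← ttE_eq q p v {0, 1, 2, 5} (fun ω => (ω.2.2.1, (ω.1, ω.2.1, ω.2.2.2.2.2), ())) ,
      ← ttE_eq q p v ∅ (fun _ => ()) ,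
      ← ttE_eq q p v {2} (fun ω => (ω.2.2.1, ())) ,
      ← ttE_eq q p v {0, 1, 5} (fun ω => ((ω.1, ω.2.1, ω.2.2.2.2.2), ())) ]
    rotate_left
    iterate 4 focus (intro ω ω'; simp [k, Prod.ext_iff, and_assoc]; try tauto)
    refine ttG_ci q hq p hp0 (fun ω => ω.2.2.1) (fun ω => (ω.1, ω.2.1, ω.2.2.2.2.2)) (fun _ => ())
      (fun _ => 1) ?_ ?_ (fun _ => pC) ?_ ?_ (fun _ t => pA t.1 * (pB t.2.1 * pZ t.1 t.2.1 t.2.2)) ?_ ?_ ?_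
    · simp
    · simp
    · exact fun _ => hpC0
    · exact fun _ => hpC1
    · intros
      (repeat' first | (refine Finset.sum_nonneg fun _ _ => ?_) | (refine mul_nonneg ?_ ?_)) <;> simp [*]
    · intros
      simp only [Fintype.sum_prod_type, ← Finset.mul_sum, n1, mul_one]
    · rintro c ⟨a, b, z⟩ u
      simp only [ttPush, Fintype.sum_prod_type, Prod.mk.injEq, and_assoc, and_true]
      simp only [ite_and, tt_pull, Finset.sum_ite_eq', Finset.mem_univ, if_true, hp, ← Finset.mul_sum, n1, mul_one]
      simp only [← Finset.sum_mul, ← Finset.mul_sum, n1, mul_one, one_mul]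
      ring1
  have i_A_X_Y := sub {0, 4} {3, 4} {0, 3, 4} {4} (by decide) (by decide)
  have i_A_X_Z := sub {0, 5} {3, 5} {0, 3, 5} {5} (by decide) (by decide)
  have i_A_Z_Y := sub {0, 4} {4, 5} {0, 4, 5} {4} (by decide) (by decide)
  have i_B_X_Z := sub {1, 5} {3, 5} {1, 3, 5} {5} (by decide) (by decide)
  have i_B_Y_X := sub {1, 3} {3, 4} {1, 3, 4} {3} (by decide) (by decide)
  have i_B_Y_Z := sub {1, 5} {4, 5} {1, 4, 5} {5} (by decide) (by decide)
  have i_B_Z_X := sub {1, 3} {3, 5} {1, 3, 5} {3} (by decide) (by decide)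
  have i_C_Y_X := sub {2, 3} {3, 4} {2, 3, 4} {3} (by decide) (by decide)
  have i_C_Z_X := sub {2, 3} {3, 5} {2, 3, 5} {3} (by decide) (by decide)
  have i_C_Z_Y := sub {2, 4} {4, 5} {2, 4, 5} {4} (by decide) (by decide)
  have i_X_Y_CZ := sub {2, 3, 5} {2, 4, 5} {2, 3, 4, 5} {2, 5} (by decide) (by decide)
  have i_X_Z_BY := sub {1, 3, 4} {1, 4, 5} {1, 3, 4, 5} {1, 4} (by decide) (by decide)
  have i_Y_Z_AX := sub {0, 3, 4} {0, 3, 5} {0, 3, 4, 5} {0, 3} (by decide) (by decide)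
  have i_A_Y_Z := sub {0, 5} {4, 5} {0, 4, 5} {5} (by decide) (by decide)
  have i_C_X_Y := sub {2, 4} {3, 4} {2, 3, 4} {4} (by decide) (by decide)
  have i_A_BC_XYZ := sub {0, 3, 4, 5} {1, 2, 3, 4, 5} {0, 1, 2, 3, 4, 5} {3, 4, 5} (by decide) (by decide)
  have i_B_C_XYZ := sub {1, 3, 4, 5} {2, 3, 4, 5} {1, 2, 3, 4, 5} {3, 4, 5} (by decide) (by decide)
  have i_A_C_XYZ := sub {0, 3, 4, 5} {2, 3, 4, 5} {0, 2, 3, 4, 5} {3, 4, 5} (by decide) (by decide)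
  have i_B_AC_XYZ := sub {1, 3, 4, 5} {0, 2, 3, 4, 5} {0, 1, 2, 3, 4, 5} {3, 4, 5} (by decide) (by decide)
  have i_AB_Y_Z := sub {0, 1, 5} {4, 5} {0, 1, 4, 5} {5} (by decide) (by decide)
  have h1 := anti {0, 1, 2} {0, 1, 2, 3, 4, 5} (by decide)
  have h2 := anti {0, 1, 2, 5} {0, 1, 2, 3, 4, 5} (by decide)
  have h3 := anti {0, 1, 4} {0, 1, 4, 5} (by decide)
  have hdu : (0 : ℝ) ≤ dU := Nat.cast_nonneg _
  have hdo : (0 : ℝ) ≤ dO := Nat.cast_nonneg _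
  simp only [Fintype.card_prod, hA, hB, hC, hX, hY, hZ, Nat.cast_mul, Real.mul_rpow hdu hdu,
    Real.mul_rpow hdu hdo, Real.mul_rpow hdu (mul_nonneg hdu hdo)] at *
  have e1 : (dU : ℝ) ^ (3 - 3 * q) = ((dU : ℝ) ^ (1 - q)) ^ 3 := by
    rw [← Real.rpow_mul_natCast hdu]; congr 1; push_cast; ring
  have e2 : (dO : ℝ) ^ (2 - 2 * q) = ((dO : ℝ) ^ (1 - q)) ^ 2 := by
    rw [← Real.rpow_mul_natCast hdo]; congr 1; push_cast; ring
  rw [TX, TY, TZ, TXY, TXZ, TYZ, TXYZ]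
  unfold B21 B22
  rw [e1, e2]
  generalize (dU : ℝ) ^ (1 - q) = u at *
  generalize (dO : ℝ) ^ (1 - q) = o at *
  have hk : 0 ≤ 1 / (q - 1) := by
    apply one_div_nonneg.2; linarith
  generalize 1 / (q - 1) = k at *
  have fin : ∀ s t : ℝ, -t ≤ s → -k * t ≤ k * s := by
    intro s t h
    have := mul_le_mul_of_nonneg_left h hk
    linarith
  have M1 := fin (5 * (E {3} + E {4} + E {5}) - 4 * (E {3, 4} + E {3, 5} + E {4, 5})
    + 2 * E {3, 4, 5} - 5) (11 + u ^ 3 + 6 * o ^ 2 + 3 * o * u - 6 * u - 15 * o) (by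
      linear_combination i_A_BC_XYZ + i_A_X_Y + i_A_X_Z + i_A_Y_Z + i_A_Z_Y + i_B_C_XYZ + i_B_X_Z + i_B_Y_X + i_B_Y_Z + i_B_Z_X + i_C_X_Y + i_C_Y_X + i_C_Z_X + i_C_Z_Y + i_X_Y_CZ + i_X_Z_BY + i_Y_Z_AX + ci_A_B_ + ci_A_X_ + ci_B_Y_ + ci_AB_C_ + ci_C_Z_ + 2 * ci_X_Y_C + 2 * ci_X_Z_B + 2 * ci_Y_Z_A + h1 + (-5) * E0)
  have M2 := fin (5 * (E {3} + E {4} + E {5}) - 4 * (E {3, 4} + E {3, 5} + E {4, 5})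
    + 2 * E {3, 4, 5} - 5) (10 + o * u ^ 3 + 5 * o ^ 2 + 2 * o * u - 5 * u - 13 * o) (by
      linear_combination i_A_C_XYZ + i_A_X_Y + i_A_X_Z + i_A_Z_Y + i_B_AC_XYZ + i_B_X_Z + i_B_Y_X + i_B_Y_Z + i_B_Z_X + i_AB_Y_Z + i_C_X_Y + i_C_Y_X + i_C_Z_X + i_C_Z_Y + i_X_Y_CZ + i_X_Z_BY + i_Y_Z_AX + ci_A_X_ + ci_B_Y_ + ci_B_AY_ + ci_C_Z_ + ci_C_ABZ_ + 2 * ci_X_Y_C + 2 * ci_X_Z_B + ci_Y_Z_A + h2 + h3 + (-5) * E0)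
  refine max_le ?_ ?_
  · linarith
  · linarith
end

section
/- Let p be a probability distribution on A × B × C × X × Y × Z compatible with the triangle causal structure, i.e. p(a,b,c,x,y,z) = p_A(a)·p_B(b)·p_C(c)·p_{X|BC}(x|b,c)·p_{Y|AC}(y|a,c)·p_{Z|AB}(z|a,b), where A, B, C each have cardinality d_u ≥ 2 and X, Y, Z each have cardinality d_o ≥ 2. Then for every real q > 1, −3S_q(X) − 3S_q(Y) − 3S_q(Z) + 2S_q(XY) + 2S_q(XZ) + 3S_q(YZ) − S_q(XYZ) ≥ B_3(q,d_o,d_u), where B_3(q,d_o,d_u) = −(1/(q−1))·(6 + d_o^{1−q}d_u^{2−2q} + 3d_o^{2−2q} + d_o^{1−q}d_u^{1−q} − 3d_u^{1−q} − 8d_o^{1−q}). -/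
open Finset

/-- The bound `B_3(q,d_o,d_u)`. -/
noncomputable def B3 (q dO dU : ℝ) : ℝ :=
  -(1 / (q - 1)) * (6 + dO ^ (1 - q) * dU ^ (2 - 2 * q) + 3 * dO ^ (2 - 2 * q)
    + dO ^ (1 - q) * dU ^ (1 - q) - 3 * dU ^ (1 - q) - 8 * dO ^ (1 - q))


lemma tsallis_eq {α : Type*} [Fintype α] (q : ℝ) (hq : 1 < q) (f : α → ℝ) (hf : ∀ x, 0 ≤ f x) :
    tsallisEnt q f = (1 - ∑ x, f x ^ q) / (q - 1) := by
  have h : ∑ x ∈ univ.filter (fun x => 0 < f x), f x ^ q = ∑ x, f x ^ q := by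
    rw [Finset.sum_filter]
    refine Finset.sum_congr rfl fun x _ => ?_
    split_ifs with h
    · rfl
    · have : f x = 0 := le_antisymm (not_lt.mp h) (hf x)
      rw [this, Real.zero_rpow (by linarith)]
  unfold tsallisEnt
  rw [h]
  have h1 : q - 1 ≠ 0 := by linarith
  have h2 : 1 - q ≠ 0 := by intro h; apply h1; linarith
  field_simp
  ring

lemma sum_rpow_le_rpow {α : Type*} [Fintype α] (q : ℝ) (hq : 1 < q) (f : α → ℝ)
    (hf : ∀ x, 0 ≤ f x) : ∑ x, f x ^ q ≤ (∑ x, f x) ^ q := by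
  have hS : 0 ≤ ∑ x, f x := Finset.sum_nonneg fun x _ => hf x
  have key : ∀ s : ℝ, 0 ≤ s → s ^ q = s * s ^ (q - 1) := by
    intro s hs
    rcases hs.eq_or_lt with h | h
    · rw [← h, Real.zero_rpow (by linarith), zero_mul]
    · rw [mul_comm, ← Real.rpow_add_one h.ne']; congr 1; ring
  rw [key _ hS, Finset.sum_mul]
  refine Finset.sum_le_sum fun x _ => ?_
  rw [key _ (hf x)]
  refine mul_le_mul_of_nonneg_left ?_ (hf x)
  exact Real.rpow_le_rpow (hf x) (Finset.single_le_sum (fun y _ => hf y) (mem_univ x))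
    (by linarith)

lemma ssa_one {S T : Type*} [Fintype S] [Fintype T] (q : ℝ) (hq : 1 < q) (w : S → T → ℝ)
    (hw : ∀ s t, 0 ≤ w s t) :
    ∑ s, (∑ t, w s t) ^ q + ∑ t, (∑ s, w s t) ^ q
      ≤ (∑ s, ∑ t, w s t) ^ q + ∑ s, ∑ t, w s t ^ q := by
  set R : ℝ := ∑ s, ∑ t, w s t with hR
  set r : S → ℝ := fun s => ∑ t, w s t with hr
  have hr0 : ∀ s, 0 ≤ r s := fun s => Finset.sum_nonneg fun t _ => hw s t
  have hR0 : 0 ≤ R := Finset.sum_nonneg fun s _ => hr0 s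
  rcases hR0.eq_or_lt with h0 | hpos
  · have hz : ∀ s t, w s t = 0 := by
      intro s t
      have h1 := (Finset.sum_eq_zero_iff_of_nonneg (fun s _ => hr0 s)).mp h0.symm s (mem_univ s)
      exact (Finset.sum_eq_zero_iff_of_nonneg (fun t _ => hw s t)).mp h1 t (mem_univ t)
    have hq0 : q ≠ 0 := by linarith
    rw [← h0]
    simp [hz, Real.zero_rpow hq0]
  have hrR : ∀ s, r s ≤ R := fun s => Finset.single_le_sum (fun y _ => hr0 y) (mem_univ s)
  -- normalised
  set n : S → T → ℝ := fun s t => w s t / r s with hn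
  have hn0 : ∀ s t, 0 ≤ n s t := fun s t => div_nonneg (hw s t) (hr0 s)
  have hwn : ∀ s t, w s t = r s * n s t := by
    intro s t
    rcases (hr0 s).eq_or_lt with h | h
    · have := (Finset.sum_eq_zero_iff_of_nonneg (fun t _ => hw s t)).mp h.symm t (mem_univ t)
      rw [this, ← h, zero_mul]
    · simp only [hn]; field_simp
  have hn1 : ∀ s, ∑ t, n s t ≤ 1 := by
    intro s
    simp only [hn]
    rw [← Finset.sum_div]
    exact div_self_le_one _
  have key : ∀ s : ℝ, 0 ≤ s → s ^ q = s * s ^ (q - 1) := by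
    intro s hs
    rcases hs.eq_or_lt with h | h
    · rw [← h, Real.zero_rpow (by linarith), zero_mul]
    · rw [mul_comm, ← Real.rpow_add_one h.ne']; congr 1; ring
  -- row bound
  have hrow : ∀ s, r s ^ q - ∑ t, w s t ^ q
      ≤ R ^ q * (r s / R) - R ^ q * ∑ t, (r s / R) * n s t ^ q := by
    intro s
    have e1 : ∑ t, w s t ^ q = r s ^ q * ∑ t, n s t ^ q := by
      rw [Finset.mul_sum]
      refine Finset.sum_congr rfl fun t _ => ?_
      rw [hwn s t, Real.mul_rpow (hr0 s) (hn0 s t)]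
    have e2 : ∑ t, n s t ^ q ≤ 1 :=
      (sum_rpow_le_rpow q hq (n s) (hn0 s)).trans
        (Real.rpow_le_one (Finset.sum_nonneg fun t _ => hn0 s t) (hn1 s) (by linarith))
    have e3 : r s ^ q ≤ R ^ q * (r s / R) := by
      rw [key _ (hr0 s), key _ hR0]
      have : R * R ^ (q - 1) * (r s / R) = r s * R ^ (q - 1) := by field_simp
      rw [this]
      exact mul_le_mul_of_nonneg_left (Real.rpow_le_rpow (hr0 s) (hrR s) (by linarith)) (hr0 s)
    rw [e1, ← Finset.mul_sum]
    nlinarith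
  have hcol : ∀ t, (∑ s, w s t) ^ q ≤ R ^ q * ∑ s, (r s / R) * n s t ^ q := by
    intro t
    have e : ∑ s, w s t = R * ∑ s, (r s / R) * n s t := by
      rw [Finset.mul_sum]
      refine Finset.sum_congr rfl fun s _ => ?_
      rw [hwn s t]; field_simp
    rw [e, Real.mul_rpow hR0 (Finset.sum_nonneg fun s _ =>
      mul_nonneg (div_nonneg (hr0 s) hR0) (hn0 s t))]
    refine mul_le_mul_of_nonneg_left ?_ (Real.rpow_nonneg hR0 _)
    refine Real.rpow_arith_mean_le_arith_mean_rpow univ _ _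
      (fun s _ => div_nonneg (hr0 s) hR0) ?_ (fun s _ => hn0 s t) hq.le
    rw [← Finset.sum_div]
    exact div_self hpos.ne'
  have H1 := Finset.sum_le_sum fun s (_ : s ∈ univ) => hrow s
  have H2 := Finset.sum_le_sum fun t (_ : t ∈ univ) => hcol t
  rw [Finset.sum_sub_distrib, Finset.sum_sub_distrib, ← Finset.mul_sum, ← Finset.mul_sum,
    ← Finset.sum_div, show (∑ s, r s) / R = 1 from div_self hpos.ne'] at H1
  rw [Finset.sum_comm (f := fun s t => r s / R * n s t ^ q)] at H1
  rw [← Finset.mul_sum] at H2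
  change ∑ s, r s ^ q + _ ≤ _
  linarith

lemma ssa {K S T : Type*} [Fintype K] [Fintype S] [Fintype T] (q : ℝ) (hq : 1 < q)
    (w : K → S → T → ℝ) (hw : ∀ k s t, 0 ≤ w k s t)
    (u : K → S → ℝ) (v : K → T → ℝ) (m : K → ℝ)
    (hu : ∀ k s, ∑ t, w k s t = u k s) (hv : ∀ k t, ∑ s, w k s t = v k t)
    (hm : ∀ k, ∑ s, u k s = m k) :
    ∑ k, ∑ s, u k s ^ q + ∑ k, ∑ t, v k t ^ q ≤ ∑ k, m k ^ q + ∑ k, ∑ s, ∑ t, w k s t ^ q := by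
  rw [← Finset.sum_add_distrib, ← Finset.sum_add_distrib]
  refine Finset.sum_le_sum fun k _ => ?_
  have := ssa_one q hq (w k) (hw k)
  simpa only [hu, hv, hm] using this

lemma pow_mean {α : Type*} [Fintype α] (q : ℝ) (hq : 1 < q) (f : α → ℝ)
    (hf : ∀ x, 0 ≤ f x) (h1 : ∑ x, f x = 1) (d : ℝ) (hd : (Fintype.card α : ℝ) = d)
    (hd0 : 0 < d) : d ^ (1 - q) ≤ ∑ x, f x ^ q := by
  have h := Real.rpow_sum_le_const_mul_sum_rpow univ f hq.le
  simp only [abs_of_nonneg (hf _), h1, Real.one_rpow, Finset.card_univ, hd] at h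
  have e : d ^ (1 - q) = (d ^ (q - 1))⁻¹ := by
    rw [← Real.rpow_neg hd0.le]; congr 1; ring
  rw [e, inv_le_iff_one_le_mul₀' (Real.rpow_pos_of_pos hd0 _)]
  exact h

lemma ci {K S T : Type*} [Fintype K] [Fintype S] [Fintype T] (q : ℝ) (hq : 1 < q)
    (w : K → S → T → ℝ) (r : K → ℝ) (f : K → S → ℝ) (g : K → T → ℝ)
    (hr : ∀ k, 0 ≤ r k) (hr1 : ∑ k, r k = 1)
    (hf : ∀ k s, 0 ≤ f k s) (hf1 : ∀ k, ∑ s, f k s = 1)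
    (hg : ∀ k s, 0 ≤ g k s) (hg1 : ∀ k, ∑ s, g k s = 1)
    (hw : ∀ k s t, w k s t = r k * f k s * g k t)
    (u : K → S → ℝ) (v : K → T → ℝ) (m : K → ℝ)
    (hu : ∀ k s, ∑ t, w k s t = u k s) (hv : ∀ k t, ∑ s, w k s t = v k t)
    (hm : ∀ k, ∑ s, u k s = m k) (dS dT : ℝ) (hS : (Fintype.card S : ℝ) = dS)
    (hT : (Fintype.card T : ℝ) = dT) (hS0 : 1 ≤ dS) (hT0 : 1 ≤ dT) :
    ∑ k, m k ^ q + ∑ k, ∑ s, ∑ t, w k s t ^ q ≤ ∑ k, ∑ s, u k s ^ q + ∑ k, ∑ t, v k t ^ q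
      + (1 - dS ^ (1 - q)) * (1 - dT ^ (1 - q)) := by
  have hu' : ∀ k s, u k s = r k * f k s := by
    intro k s; rw [← hu]; simp only [hw]; rw [← Finset.mul_sum, hg1, mul_one]
  have hv' : ∀ k t, v k t = r k * g k t := by
    intro k t; rw [← hv]; simp only [hw]; rw [← Finset.sum_mul, ← Finset.mul_sum, hf1, mul_one]
  have hm' : ∀ k, m k = r k := by
    intro k; rw [← hm]; simp only [hu']; rw [← Finset.mul_sum, hf1, mul_one]
  have hD : ∀ d : ℝ, 1 ≤ d → d ^ (1 - q) ≤ 1 := fun d hd =>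
    Real.rpow_le_one_of_one_le_of_nonpos hd (by linarith)
  have hDS := hD dS hS0
  have hDT := hD dT hT0
  have hr2 : ∑ k, r k ^ q ≤ 1 := by
    have := sum_rpow_le_rpow q hq r hr
    rwa [hr1, Real.one_rpow] at this
  have hk : ∀ k, r k ^ q + ∑ s, ∑ t, w k s t ^ q ≤ ∑ s, u k s ^ q + ∑ t, v k t ^ q
      + r k ^ q * ((1 - dS ^ (1 - q)) * (1 - dT ^ (1 - q))) := by
    intro k
    have e1 : ∑ s, u k s ^ q = r k ^ q * ∑ s, f k s ^ q := by
      rw [Finset.mul_sum]; refine Finset.sum_congr rfl fun s _ => ?_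
      rw [hu', Real.mul_rpow (hr k) (hf k s)]
    have e2 : ∑ t, v k t ^ q = r k ^ q * ∑ t, g k t ^ q := by
      rw [Finset.mul_sum]; refine Finset.sum_congr rfl fun s _ => ?_
      rw [hv', Real.mul_rpow (hr k) (hg k s)]
    have e3 : ∑ s, ∑ t, w k s t ^ q = r k ^ q * ((∑ s, f k s ^ q) * ∑ t, g k t ^ q) := by
      rw [Finset.sum_mul_sum, Finset.mul_sum]; refine Finset.sum_congr rfl fun s _ => ?_
      rw [Finset.mul_sum]; refine Finset.sum_congr rfl fun t _ => ?_
      rw [hw, Real.mul_rpow (mul_nonneg (hr k) (hf k s)) (hg k t),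
        Real.mul_rpow (hr k) (hf k s), mul_assoc]
    have b1 := pow_mean q hq (f k) (hf k) (hf1 k) dS hS (by linarith)
    have b2 := pow_mean q hq (g k) (hg k) (hg1 k) dT hT (by linarith)
    have c1 : ∑ s, f k s ^ q ≤ 1 := by
      have := sum_rpow_le_rpow q hq (f k) (hf k)
      rwa [hf1, Real.one_rpow] at this
    have c2 : ∑ s, g k s ^ q ≤ 1 := by
      have := sum_rpow_le_rpow q hq (g k) (hg k)
      rwa [hg1, Real.one_rpow] at this
    rw [e1, e2, e3]
    have := mul_le_mul_of_nonneg_left (mul_le_mul (sub_le_sub_left b1 1) (sub_le_sub_left b2 1)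
      (by linarith) (by linarith)) (Real.rpow_nonneg (hr k) q)
    linarith
  have H := Finset.sum_le_sum fun k (_ : k ∈ univ) => hk k
  simp only [Finset.sum_add_distrib, ← Finset.sum_mul] at H
  simp only [hm']
  have := mul_le_mul_of_nonneg_right hr2
    (mul_nonneg (sub_nonneg.mpr hDS) (sub_nonneg.mpr hDT))
  linarith

lemma ci0 {S T : Type*} [Fintype S] [Fintype T] (q : ℝ) (hq : 1 < q)
    (w : S → T → ℝ) (f : S → ℝ) (g : T → ℝ)
    (hf : ∀ s, 0 ≤ f s) (hf1 : ∑ s, f s = 1)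
    (hg : ∀ s, 0 ≤ g s) (hg1 : ∑ s, g s = 1)
    (hw : ∀ s t, w s t = f s * g t) (u : S → ℝ) (v : T → ℝ)
    (hu : ∀ s, ∑ t, w s t = u s) (hv : ∀ t, ∑ s, w s t = v t)
    (dS dT : ℝ) (hS : (Fintype.card S : ℝ) = dS)
    (hT : (Fintype.card T : ℝ) = dT) (hS0 : 1 ≤ dS) (hT0 : 1 ≤ dT) :
    1 + ∑ s, ∑ t, w s t ^ q ≤ ∑ s, u s ^ q + ∑ t, v t ^ q
      + (1 - dS ^ (1 - q)) * (1 - dT ^ (1 - q)) := by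
  have := ci (K := Unit) q hq (fun _ => w) (fun _ => 1) (fun _ => f) (fun _ => g)
    (by simp) (by simp) (fun _ => hf) (fun _ => hf1) (fun _ => hg) (fun _ => hg1)
    (by simp [hw]) (fun _ => u) (fun _ => v) (fun _ => 1)
    (fun _ => hu) (fun _ => hv)
    (by intro _; simp only [← hu, hw]; rw [← hf1]; refine Finset.sum_congr rfl fun s _ => ?_
        rw [← Finset.mul_sum, hg1, mul_one]) dS dT hS hT hS0 hT0
  simpa using this

lemma push2 {α β γ : Type*} [Fintype α] [Fintype β] [Fintype γ] (f : α → β → γ → ℝ) :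
    ∑ t, ∑ a, ∑ b, f t a b = ∑ a, ∑ b, ∑ t, f t a b := by
  rw [Finset.sum_comm]; refine Finset.sum_congr rfl fun _ _ => Finset.sum_comm

lemma push3 {α β γ δ : Type*} [Fintype α] [Fintype β] [Fintype γ] [Fintype δ]
    (f : α → β → γ → δ → ℝ) :
    ∑ t, ∑ a, ∑ b, ∑ c, f t a b c = ∑ a, ∑ b, ∑ c, ∑ t, f t a b c := by
  rw [Finset.sum_comm]; refine Finset.sum_congr rfl fun _ _ => push2 _

lemma push4 {α β γ δ ε : Type*} [Fintype α] [Fintype β] [Fintype γ] [Fintype δ] [Fintype ε]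
    (f : α → β → γ → δ → ε → ℝ) :
    ∑ t, ∑ a, ∑ b, ∑ c, ∑ d, f t a b c d = ∑ a, ∑ b, ∑ c, ∑ d, ∑ t, f t a b c d := by
  rw [Finset.sum_comm]; refine Finset.sum_congr rfl fun _ _ => push3 _

lemma mix_one {α β : Type*} [Fintype α] [Fintype β] (r : α → ℝ) (f : α → β → ℝ)
    (hr : ∑ a, r a = 1) (hf : ∀ a, ∑ b, f a b = 1) : ∑ b, ∑ a, r a * f a b = 1 := by
  rw [Finset.sum_comm]; simp only [← Finset.mul_sum, hf, mul_one, hr]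

set_option maxHeartbeats 1000000 in
lemma core {A C X Y Z : Type*} [Fintype A] [Fintype C] [Fintype X] [Fintype Y] [Fintype Z]
    (q : ℝ) (hq : 1 < q) (W : A → C → X → Y → Z → ℝ) (hW : ∀ a c x y z, 0 ≤ W a c x y z) :
    0 ≤ 3 * (∑ x, (∑ a, ∑ c, ∑ y, ∑ z, W a c x y z) ^ q) + 3 * (∑ y, (∑ a, ∑ c, ∑ x, ∑ z, W a c x y z) ^ q) + 3 * (∑ z, (∑ a, ∑ c, ∑ x, ∑ y, W a c x y z) ^ q)
      - 2 * (∑ x, ∑ y, (∑ a, ∑ c, ∑ z, W a c x y z) ^ q) - 2 * (∑ x, ∑ z, (∑ a, ∑ c, ∑ y, W a c x y z) ^ q) - 3 * (∑ y, ∑ z, (∑ a, ∑ c, ∑ x, W a c x y z) ^ q)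
      + (∑ x, ∑ y, ∑ z, (∑ a, ∑ c, W a c x y z) ^ q)
      + 2 * ((∑ a, ∑ y, ∑ z, (∑ c, ∑ x, W a c x y z) ^ q) + (∑ a, (∑ c, ∑ x, ∑ y, ∑ z, W a c x y z) ^ q) - (∑ a, ∑ y, (∑ c, ∑ x, ∑ z, W a c x y z) ^ q) - (∑ a, ∑ z, (∑ c, ∑ x, ∑ y, W a c x y z) ^ q))
      + ((∑ c, ∑ z, (∑ a, ∑ x, ∑ y, W a c x y z) ^ q) - (∑ c, (∑ a, ∑ x, ∑ y, ∑ z, W a c x y z) ^ q) - (∑ z, (∑ a, ∑ c, ∑ x, ∑ y, W a c x y z) ^ q))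
      + ((∑ a, ∑ x, (∑ c, ∑ y, ∑ z, W a c x y z) ^ q) - (∑ a, (∑ c, ∑ x, ∑ y, ∑ z, W a c x y z) ^ q) - (∑ x, (∑ a, ∑ c, ∑ y, ∑ z, W a c x y z) ^ q))
      + ((∑ a, ∑ c, ∑ x, (∑ y, ∑ z, W a c x y z) ^ q) - (∑ a, (∑ c, ∑ x, ∑ y, ∑ z, W a c x y z) ^ q) - (∑ c, ∑ x, (∑ a, ∑ y, ∑ z, W a c x y z) ^ q))
      + ((∑ c, ∑ x, ∑ y, (∑ a, ∑ z, W a c x y z) ^ q) + (∑ c, (∑ a, ∑ x, ∑ y, ∑ z, W a c x y z) ^ q) - (∑ c, ∑ x, (∑ a, ∑ y, ∑ z, W a c x y z) ^ q) - (∑ c, ∑ y, (∑ a, ∑ x, ∑ z, W a c x y z) ^ q)) := by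
  obtain ⟨mXYZ, hXYZ⟩ : ∃ f : X → Y → Z → ℝ, ∀ x y z, f x y z = ∑ a, ∑ c, W a c x y z :=
    ⟨_, fun _ _ _ => rfl⟩
  obtain ⟨mAXYZ, hAXYZ⟩ : ∃ f : A → X → Y → Z → ℝ, ∀ a x y z, f a x y z = ∑ c, W a c x y z :=
    ⟨_, fun _ _ _ _ => rfl⟩
  obtain ⟨mCXYZ, hCXYZ⟩ : ∃ f : C → X → Y → Z → ℝ, ∀ c x y z, f c x y z = ∑ a, W a c x y z :=
    ⟨_, fun _ _ _ _ => rfl⟩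
  obtain ⟨mAYZ, hAYZ⟩ : ∃ f : A → Y → Z → ℝ, ∀ a y z, f a y z = ∑ c, ∑ x, W a c x y z :=
    ⟨_, fun _ _ _ => rfl⟩
  obtain ⟨mAXZ, hAXZ⟩ : ∃ f : A → X → Z → ℝ, ∀ a x z, f a x z = ∑ c, ∑ y, W a c x y z :=
    ⟨_, fun _ _ _ => rfl⟩
  obtain ⟨mAXY, hAXY⟩ : ∃ f : A → X → Y → ℝ, ∀ a x y, f a x y = ∑ c, ∑ z, W a c x y z :=
    ⟨_, fun _ _ _ => rfl⟩
  obtain ⟨mCYZ, hCYZ⟩ : ∃ f : C → Y → Z → ℝ, ∀ c y z, f c y z = ∑ a, ∑ x, W a c x y z :=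
    ⟨_, fun _ _ _ => rfl⟩
  obtain ⟨mCXY, hCXY⟩ : ∃ f : C → X → Y → ℝ, ∀ c x y, f c x y = ∑ a, ∑ z, W a c x y z :=
    ⟨_, fun _ _ _ => rfl⟩
  obtain ⟨mCXZ, hCXZ⟩ : ∃ f : C → X → Z → ℝ, ∀ c x z, f c x z = ∑ a, ∑ y, W a c x y z :=
    ⟨_, fun _ _ _ => rfl⟩
  obtain ⟨mACX, hACX⟩ : ∃ f : A → C → X → ℝ, ∀ a c x, f a c x = ∑ y, ∑ z, W a c x y z :=
    ⟨_, fun _ _ _ => rfl⟩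
  obtain ⟨mAZ, hAZ⟩ : ∃ f : A → Z → ℝ, ∀ a z, f a z = ∑ c, ∑ x, ∑ y, W a c x y z :=
    ⟨_, fun _ _ => rfl⟩
  obtain ⟨mAY, hAY⟩ : ∃ f : A → Y → ℝ, ∀ a y, f a y = ∑ c, ∑ x, ∑ z, W a c x y z :=
    ⟨_, fun _ _ => rfl⟩
  obtain ⟨mYZ, hYZ⟩ : ∃ f : Y → Z → ℝ, ∀ y z, f y z = ∑ a, ∑ c, ∑ x, W a c x y z :=
    ⟨_, fun _ _ => rfl⟩
  obtain ⟨mXZ, hXZ⟩ : ∃ f : X → Z → ℝ, ∀ x z, f x z = ∑ a, ∑ c, ∑ y, W a c x y z :=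
    ⟨_, fun _ _ => rfl⟩
  obtain ⟨mXY, hXY⟩ : ∃ f : X → Y → ℝ, ∀ x y, f x y = ∑ a, ∑ c, ∑ z, W a c x y z :=
    ⟨_, fun _ _ => rfl⟩
  obtain ⟨mCY, hCY⟩ : ∃ f : C → Y → ℝ, ∀ c y, f c y = ∑ a, ∑ x, ∑ z, W a c x y z :=
    ⟨_, fun _ _ => rfl⟩
  obtain ⟨mCX, hCX⟩ : ∃ f : C → X → ℝ, ∀ c x, f c x = ∑ a, ∑ y, ∑ z, W a c x y z :=
    ⟨_, fun _ _ => rfl⟩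
  obtain ⟨mCZ, hCZ⟩ : ∃ f : C → Z → ℝ, ∀ c z, f c z = ∑ a, ∑ x, ∑ y, W a c x y z :=
    ⟨_, fun _ _ => rfl⟩
  obtain ⟨mAX, hAX⟩ : ∃ f : A → X → ℝ, ∀ a x, f a x = ∑ c, ∑ y, ∑ z, W a c x y z :=
    ⟨_, fun _ _ => rfl⟩
  obtain ⟨mA, hA⟩ : ∃ f : A → ℝ, ∀ a, f a = ∑ c, ∑ x, ∑ y, ∑ z, W a c x y z :=
    ⟨_, fun _ => rfl⟩
  obtain ⟨mC, hC⟩ : ∃ f : C → ℝ, ∀ c, f c = ∑ a, ∑ x, ∑ y, ∑ z, W a c x y z :=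
    ⟨_, fun _ => rfl⟩
  obtain ⟨mX, hX⟩ : ∃ f : X → ℝ, ∀ x, f x = ∑ a, ∑ c, ∑ y, ∑ z, W a c x y z :=
    ⟨_, fun _ => rfl⟩
  obtain ⟨mY, hY⟩ : ∃ f : Y → ℝ, ∀ y, f y = ∑ a, ∑ c, ∑ x, ∑ z, W a c x y z :=
    ⟨_, fun _ => rfl⟩
  obtain ⟨mZ, hZ⟩ : ∃ f : Z → ℝ, ∀ z, f z = ∑ a, ∑ c, ∑ x, ∑ y, W a c x y z :=
    ⟨_, fun _ => rfl⟩
  obtain ⟨FXYZ, eXYZ⟩ : ∃ F : ℝ, (∑ x, ∑ y, ∑ z, (mXYZ x y z) ^ q) = F := by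
    exact ⟨_, rfl⟩
  obtain ⟨FAXYZ, eAXYZ, eXYZA⟩ : ∃ F : ℝ, (∑ a, ∑ x, ∑ y, ∑ z, (mAXYZ a x y z) ^ q) = F ∧ (∑ x, ∑ y, ∑ z, ∑ a, (mAXYZ a x y z) ^ q) = F := by
    refine ⟨_, rfl, ?_⟩
    · exact (push3 _).symm
  obtain ⟨FCXYZ, eCXYZ, eXYZC, eCZXY⟩ : ∃ F : ℝ, (∑ c, ∑ x, ∑ y, ∑ z, (mCXYZ c x y z) ^ q) = F ∧ (∑ x, ∑ y, ∑ z, ∑ c, (mCXYZ c x y z) ^ q) = F ∧ (∑ c, ∑ z, ∑ x, ∑ y, (mCXYZ c x y z) ^ q) = F := by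
    refine ⟨_, rfl, ?_, ?_⟩
    · exact (push3 _).symm
    · refine Finset.sum_congr rfl fun _ _ => ?_; refine (Finset.sum_comm).trans ?_; refine Finset.sum_congr rfl fun _ _ => ?_; exact Finset.sum_comm
  obtain ⟨FACXYZ, eACXYZ, eXYZAC⟩ : ∃ F : ℝ, (∑ a, ∑ c, ∑ x, ∑ y, ∑ z, (W a c x y z) ^ q) = F ∧ (∑ x, ∑ y, ∑ z, ∑ a, ∑ c, (W a c x y z) ^ q) = F := by
    refine ⟨_, rfl, ?_⟩
    rw [← push3]
    refine Finset.sum_congr rfl fun _ _ => ?_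
    exact (push3 _).symm
  obtain ⟨FZ, eZ⟩ : ∃ F : ℝ, (∑ z, (mZ z) ^ q) = F := by
    exact ⟨_, rfl⟩
  obtain ⟨FAZ, eAZ, eZA⟩ : ∃ F : ℝ, (∑ a, ∑ z, (mAZ a z) ^ q) = F ∧ (∑ z, ∑ a, (mAZ a z) ^ q) = F := by
    refine ⟨_, rfl, ?_⟩
    · exact Finset.sum_comm
  obtain ⟨FYZ, eYZ, eZY⟩ : ∃ F : ℝ, (∑ y, ∑ z, (mYZ y z) ^ q) = F ∧ (∑ z, ∑ y, (mYZ y z) ^ q) = F := by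
    refine ⟨_, rfl, ?_⟩
    · exact Finset.sum_comm
  obtain ⟨FAYZ, eAYZ, eZAY, eYAZ⟩ : ∃ F : ℝ, (∑ a, ∑ y, ∑ z, (mAYZ a y z) ^ q) = F ∧ (∑ z, ∑ a, ∑ y, (mAYZ a y z) ^ q) = F ∧ (∑ y, ∑ a, ∑ z, (mAYZ a y z) ^ q) = F := by
    refine ⟨_, rfl, ?_, ?_⟩
    · refine (Finset.sum_comm).trans ?_; refine Finset.sum_congr rfl fun _ _ => ?_; exact Finset.sum_comm
    · exact Finset.sum_comm
  obtain ⟨FXZ, eXZ, eZX⟩ : ∃ F : ℝ, (∑ x, ∑ z, (mXZ x z) ^ q) = F ∧ (∑ z, ∑ x, (mXZ x z) ^ q) = F := by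
    refine ⟨_, rfl, ?_⟩
    · exact Finset.sum_comm
  obtain ⟨FAXZ, eAXZ, eZAX⟩ : ∃ F : ℝ, (∑ a, ∑ x, ∑ z, (mAXZ a x z) ^ q) = F ∧ (∑ z, ∑ a, ∑ x, (mAXZ a x z) ^ q) = F := by
    refine ⟨_, rfl, ?_⟩
    · refine (Finset.sum_comm).trans ?_; refine Finset.sum_congr rfl fun _ _ => ?_; exact Finset.sum_comm
  obtain ⟨FY, eY⟩ : ∃ F : ℝ, (∑ y, (mY y) ^ q) = F := by
    exact ⟨_, rfl⟩
  obtain ⟨FCY, eCY, eYC⟩ : ∃ F : ℝ, (∑ c, ∑ y, (mCY c y) ^ q) = F ∧ (∑ y, ∑ c, (mCY c y) ^ q) = F := by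
    refine ⟨_, rfl, ?_⟩
    · exact Finset.sum_comm
  obtain ⟨FCYZ, eCYZ, eYCZ, eCZY⟩ : ∃ F : ℝ, (∑ c, ∑ y, ∑ z, (mCYZ c y z) ^ q) = F ∧ (∑ y, ∑ c, ∑ z, (mCYZ c y z) ^ q) = F ∧ (∑ c, ∑ z, ∑ y, (mCYZ c y z) ^ q) = F := by
    refine ⟨_, rfl, ?_, ?_⟩
    · exact Finset.sum_comm
    · refine Finset.sum_congr rfl fun _ _ => ?_; exact Finset.sum_comm
  obtain ⟨FAY, eAY, eYA⟩ : ∃ F : ℝ, (∑ a, ∑ y, (mAY a y) ^ q) = F ∧ (∑ y, ∑ a, (mAY a y) ^ q) = F := by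
    refine ⟨_, rfl, ?_⟩
    · exact Finset.sum_comm
  obtain ⟨FXY, eXY, eYX⟩ : ∃ F : ℝ, (∑ x, ∑ y, (mXY x y) ^ q) = F ∧ (∑ y, ∑ x, (mXY x y) ^ q) = F := by
    refine ⟨_, rfl, ?_⟩
    · exact Finset.sum_comm
  obtain ⟨FAXY, eAXY, eYAX⟩ : ∃ F : ℝ, (∑ a, ∑ x, ∑ y, (mAXY a x y) ^ q) = F ∧ (∑ y, ∑ a, ∑ x, (mAXY a x y) ^ q) = F := by
    refine ⟨_, rfl, ?_⟩
    · refine (Finset.sum_comm).trans ?_; refine Finset.sum_congr rfl fun _ _ => ?_; exact Finset.sum_comm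
  obtain ⟨FX, eX⟩ : ∃ F : ℝ, (∑ x, (mX x) ^ q) = F := by
    exact ⟨_, rfl⟩
  obtain ⟨FCX, eCX, eXC⟩ : ∃ F : ℝ, (∑ c, ∑ x, (mCX c x) ^ q) = F ∧ (∑ x, ∑ c, (mCX c x) ^ q) = F := by
    refine ⟨_, rfl, ?_⟩
    · exact Finset.sum_comm
  obtain ⟨FCXY, eCXY, eXCY⟩ : ∃ F : ℝ, (∑ c, ∑ x, ∑ y, (mCXY c x y) ^ q) = F ∧ (∑ x, ∑ c, ∑ y, (mCXY c x y) ^ q) = F := by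
    refine ⟨_, rfl, ?_⟩
    · exact Finset.sum_comm
  obtain ⟨FCZ, eCZ⟩ : ∃ F : ℝ, (∑ c, ∑ z, (mCZ c z) ^ q) = F := by
    exact ⟨_, rfl⟩
  obtain ⟨FCXZ, eCXZ, eCZX, eXCZ⟩ : ∃ F : ℝ, (∑ c, ∑ x, ∑ z, (mCXZ c x z) ^ q) = F ∧ (∑ c, ∑ z, ∑ x, (mCXZ c x z) ^ q) = F ∧ (∑ x, ∑ c, ∑ z, (mCXZ c x z) ^ q) = F := by
    refine ⟨_, rfl, ?_, ?_⟩
    · refine Finset.sum_congr rfl fun _ _ => ?_; exact Finset.sum_comm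
    · exact Finset.sum_comm
  obtain ⟨FAX, eAX⟩ : ∃ F : ℝ, (∑ a, ∑ x, (mAX a x) ^ q) = F := by
    exact ⟨_, rfl⟩
  obtain ⟨FACX, eACX⟩ : ∃ F : ℝ, (∑ a, ∑ c, ∑ x, (mACX a c x) ^ q) = F := by
    exact ⟨_, rfl⟩
  obtain ⟨FA, eA⟩ : ∃ F : ℝ, (∑ a, (mA a) ^ q) = F := by
    exact ⟨_, rfl⟩
  obtain ⟨FC, eC⟩ : ∃ F : ℝ, (∑ c, (mC c) ^ q) = F := by
    exact ⟨_, rfl⟩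
  have s0 : FAXYZ + FCXYZ ≤ FXYZ + FACXYZ := by
    have h := ssa (K := X × Y × Z) (S := A) (T := C) q hq (fun k a c => W a c k.1 k.2.1 k.2.2) (fun _ _ _ => hW _ _ _ _ _)
      (fun k a => mAXYZ a k.1 k.2.1 k.2.2) (fun k c => mCXYZ c k.1 k.2.1 k.2.2) (fun k  => mXYZ k.1 k.2.1 k.2.2)
      (by intros; simp only [hAXYZ])
      (by intros; simp only [hCXYZ])
      (by intros; simp only [hAXYZ, hXYZ])
    simp only [Fintype.sum_prod_type, eXYZ, eXYZA, eXYZC, eXYZAC] at h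
    exact h
  have s1 : FAZ + FYZ ≤ FZ + FAYZ := by
    have h := ssa (K := Z) (S := A) (T := Y) q hq (fun z a y => mAYZ a y z) (by intros; rw [hAYZ]; (repeat' refine Finset.sum_nonneg fun _ _ => ?_); exact hW _ _ _ _ _)
      (fun z a => mAZ a z) (fun z y => mYZ y z) (fun z  => mZ z)
      (by intros; simp only [hAYZ, hAZ]; refine (Finset.sum_comm).trans ?_; refine Finset.sum_congr rfl fun _ _ => ?_; exact Finset.sum_comm)
      (by intros; simp only [hAYZ, hYZ])
      (by intros; simp only [hAZ, hZ])
    simp only [eZ, eZA, eZY, eZAY] at h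
    exact h
  have s2 : FAZ + FXZ ≤ FZ + FAXZ := by
    have h := ssa (K := Z) (S := A) (T := X) q hq (fun z a x => mAXZ a x z) (by intros; rw [hAXZ]; (repeat' refine Finset.sum_nonneg fun _ _ => ?_); exact hW _ _ _ _ _)
      (fun z a => mAZ a z) (fun z x => mXZ x z) (fun z  => mZ z)
      (by intros; simp only [hAXZ, hAZ]; exact Finset.sum_comm)
      (by intros; simp only [hAXZ, hXZ])
      (by intros; simp only [hAZ, hZ])
    simp only [eZ, eZA, eZX, eZAX] at h
    exact h
  have s3 : FCY + FYZ ≤ FY + FCYZ := by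
    have h := ssa (K := Y) (S := C) (T := Z) q hq (fun y c z => mCYZ c y z) (by intros; rw [hCYZ]; (repeat' refine Finset.sum_nonneg fun _ _ => ?_); exact hW _ _ _ _ _)
      (fun y c => mCY c y) (fun y z => mYZ y z) (fun y  => mY y)
      (by intros; simp only [hCYZ, hCY]; refine (Finset.sum_comm).trans ?_; refine Finset.sum_congr rfl fun _ _ => ?_; exact Finset.sum_comm)
      (by intros; simp only [hCYZ, hYZ]; exact Finset.sum_comm)
      (by intros; simp only [hCY, hY]; exact Finset.sum_comm)
    simp only [eY, eYC, eYZ, eYCZ] at h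
    exact h
  have s4 : FAY + FXY ≤ FY + FAXY := by
    have h := ssa (K := Y) (S := A) (T := X) q hq (fun y a x => mAXY a x y) (by intros; rw [hAXY]; (repeat' refine Finset.sum_nonneg fun _ _ => ?_); exact hW _ _ _ _ _)
      (fun y a => mAY a y) (fun y x => mXY x y) (fun y  => mY y)
      (by intros; simp only [hAXY, hAY]; exact Finset.sum_comm)
      (by intros; simp only [hAXY, hXY])
      (by intros; simp only [hAY, hY])
    simp only [eY, eYA, eYX, eYAX] at h
    exact h
  have s5 : FAY + FYZ ≤ FY + FAYZ := by
    have h := ssa (K := Y) (S := A) (T := Z) q hq (fun y a z => mAYZ a y z) (by intros; rw [hAYZ]; (repeat' refine Finset.sum_nonneg fun _ _ => ?_); exact hW _ _ _ _ _)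
      (fun y a => mAY a y) (fun y z => mYZ y z) (fun y  => mY y)
      (by intros; simp only [hAYZ, hAY]; refine (Finset.sum_comm).trans ?_; refine Finset.sum_congr rfl fun _ _ => ?_; exact Finset.sum_comm)
      (by intros; simp only [hAYZ, hYZ])
      (by intros; simp only [hAY, hY])
    simp only [eY, eYA, eYZ, eYAZ] at h
    exact h
  have s6 : FCX + FXY ≤ FX + FCXY := by
    have h := ssa (K := X) (S := C) (T := Y) q hq (fun x c y => mCXY c x y) (by intros; rw [hCXY]; (repeat' refine Finset.sum_nonneg fun _ _ => ?_); exact hW _ _ _ _ _)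
      (fun x c => mCX c x) (fun x y => mXY x y) (fun x  => mX x)
      (by intros; simp only [hCXY, hCX]; exact Finset.sum_comm)
      (by intros; simp only [hCXY, hXY]; exact Finset.sum_comm)
      (by intros; simp only [hCX, hX]; exact Finset.sum_comm)
    simp only [eX, eXC, eXY, eXCY] at h
    exact h
  have s7 : FCXZ + FCYZ ≤ FCZ + FCXYZ := by
    have h := ssa (K := C × Z) (S := X) (T := Y) q hq (fun k x y => mCXYZ k.1 x y k.2) (by intros; rw [hCXYZ]; (repeat' refine Finset.sum_nonneg fun _ _ => ?_); exact hW _ _ _ _ _)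
      (fun k x => mCXZ k.1 x k.2) (fun k y => mCYZ k.1 y k.2) (fun k  => mCZ k.1 k.2)
      (by intros; simp only [hCXYZ, hCXZ]; exact Finset.sum_comm)
      (by intros; simp only [hCXYZ, hCYZ]; exact Finset.sum_comm)
      (by intros; simp only [hCXZ, hCZ]; exact Finset.sum_comm)
    simp only [Fintype.sum_prod_type, eCZ, eCZX, eCZY, eCZXY] at h
    exact h
  have s8 : FCX + FXZ ≤ FX + FCXZ := by
    have h := ssa (K := X) (S := C) (T := Z) q hq (fun x c z => mCXZ c x z) (by intros; rw [hCXZ]; (repeat' refine Finset.sum_nonneg fun _ _ => ?_); exact hW _ _ _ _ _)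
      (fun x c => mCX c x) (fun x z => mXZ x z) (fun x  => mX x)
      (by intros; simp only [hCXZ, hCX]; refine (Finset.sum_comm).trans ?_; refine Finset.sum_congr rfl fun _ _ => ?_; exact Finset.sum_comm)
      (by intros; simp only [hCXZ, hXZ]; exact Finset.sum_comm)
      (by intros; simp only [hCX, hX]; exact Finset.sum_comm)
    simp only [eX, eXC, eXZ, eXCZ] at h
    exact h
  have s9 : FAXY + FAXZ ≤ FAX + FAXYZ := by
    have h := ssa (K := A × X) (S := Y) (T := Z) q hq (fun k y z => mAXYZ k.1 k.2 y z) (by intros; rw [hAXYZ]; (repeat' refine Finset.sum_nonneg fun _ _ => ?_); exact hW _ _ _ _ _)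
      (fun k y => mAXY k.1 k.2 y) (fun k z => mAXZ k.1 k.2 z) (fun k  => mAX k.1 k.2)
      (by intros; simp only [hAXYZ, hAXY]; exact Finset.sum_comm)
      (by intros; simp only [hAXYZ, hAXZ]; exact Finset.sum_comm)
      (by intros; simp only [hAXY, hAX]; exact Finset.sum_comm)
    simp only [Fintype.sum_prod_type, eAX, eAXY, eAXZ, eAXYZ] at h
    exact h
  have smono : FACXYZ ≤ FACX := by
    rw [← eACXYZ, ← eACX]
    refine Finset.sum_le_sum fun a _ => Finset.sum_le_sum fun c _ => Finset.sum_le_sum fun x _ => ?_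
    have h := sum_rpow_le_rpow q hq (fun k : Y × Z => W a c x k.1 k.2) (fun _ => hW _ _ _ _ _)
    simp only [Fintype.sum_prod_type] at h
    rw [hACX]; exact h
  simp only [hX, hY, hZ, hXY, hXZ, hYZ, hXYZ, hAYZ, hA, hAY, hAZ, hCZ, hC, hAX, hACX, hCX, hCXY, hCY] at eX eY eZ eXY eXZ eYZ eXYZ eAYZ eA eAY eAZ eCZ eC eAX eACX eCX eCXY eCY
  simp only [eX, eY, eZ, eXY, eXZ, eYZ, eXYZ, eAYZ, eA, eAY, eAZ, eCZ, eC, eAX, eACX, eCX, eCXY, eCY]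
  linarith

set_option maxHeartbeats 1000000 in
/-- For any distribution compatible with the triangle causal structure, with
unobserved nodes of cardinality `d_u ≥ 2` and observed nodes of cardinality
`d_o ≥ 2`, and any `q > 1`:
`−3S_q(X) − 3S_q(Y) − 3S_q(Z) + 2S_q(XY) + 2S_q(XZ) + 3S_q(YZ) − S_q(XYZ)
  ≥ B_3(q,d_o,d_u)`. -/
theorem triangle_tsallis_ineq_three
    {A B C X Y Z : Type*} [Fintype A] [Fintype B] [Fintype C]
    [Fintype X] [Fintype Y] [Fintype Z]
    (dU dO : ℕ) (hdU : 2 ≤ dU) (hdO : 2 ≤ dO)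
    (hA : Fintype.card A = dU) (hB : Fintype.card B = dU) (hC : Fintype.card C = dU)
    (hX : Fintype.card X = dO) (hY : Fintype.card Y = dO) (hZ : Fintype.card Z = dO)
    (pA : A → ℝ) (hpA0 : ∀ a, 0 ≤ pA a) (hpA1 : ∑ a, pA a = 1)
    (pB : B → ℝ) (hpB0 : ∀ b, 0 ≤ pB b) (hpB1 : ∑ b, pB b = 1)
    (pC : C → ℝ) (hpC0 : ∀ c, 0 ≤ pC c) (hpC1 : ∑ c, pC c = 1)
    (pX : B → C → X → ℝ) (hpX0 : ∀ b c x, 0 ≤ pX b c x) (hpX1 : ∀ b c, ∑ x, pX b c x = 1)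
    (pY : A → C → Y → ℝ) (hpY0 : ∀ a c y, 0 ≤ pY a c y) (hpY1 : ∀ a c, ∑ y, pY a c y = 1)
    (pZ : A → B → Z → ℝ) (hpZ0 : ∀ a b z, 0 ≤ pZ a b z) (hpZ1 : ∀ a b, ∑ z, pZ a b z = 1)
    (p : A × B × C × X × Y × Z → ℝ)
    (hp : ∀ a b c x y z, p (a, b, c, x, y, z)
      = pA a * pB b * pC c * pX b c x * pY a c y * pZ a b z)
    (q : ℝ) (hq : 1 < q) :
    - 3 * tsallisEnt q (fun x => ∑ a, ∑ b, ∑ c, ∑ y, ∑ z, p (a, b, c, x, y, z))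
      - 3 * tsallisEnt q (fun y => ∑ a, ∑ b, ∑ c, ∑ x, ∑ z, p (a, b, c, x, y, z))
      - 3 * tsallisEnt q (fun z => ∑ a, ∑ b, ∑ c, ∑ x, ∑ y, p (a, b, c, x, y, z))
      + 2 * tsallisEnt q (fun w : X × Y => ∑ a, ∑ b, ∑ c, ∑ z, p (a, b, c, w.1, w.2, z))
      + 2 * tsallisEnt q (fun w : X × Z => ∑ a, ∑ b, ∑ c, ∑ y, p (a, b, c, w.1, y, w.2))
      + 3 * tsallisEnt q (fun w : Y × Z => ∑ a, ∑ b, ∑ c, ∑ x, p (a, b, c, x, w.1, w.2))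
      - tsallisEnt q (fun w : X × Y × Z => ∑ a, ∑ b, ∑ c, p (a, b, c, w.1, w.2.1, w.2.2))
      ≥ B3 q dO dU := by
  obtain ⟨W, hWd⟩ : ∃ W : A → C → X → Y → Z → ℝ, ∀ a c x y z,
      W a c x y z = ∑ b, p (a, b, c, x, y, z) := ⟨_, fun _ _ _ _ _ => rfl⟩
  have hp0 : ∀ a b c x y z, 0 ≤ p (a, b, c, x, y, z) := by
    intro a b c x y z
    rw [hp]
    exact mul_nonneg (mul_nonneg (mul_nonneg (mul_nonneg (mul_nonneg (hpA0 a) (hpB0 b)) (hpC0 c))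
      (hpX0 b c x)) (hpY0 a c y)) (hpZ0 a b z)
  have hW0 : ∀ a c x y z, 0 ≤ W a c x y z := by
    intro a c x y z; rw [hWd]; exact Finset.sum_nonneg fun b _ => hp0 _ _ _ _ _ _
  have E1 : ∀ a c y z, ∑ x, W a c x y z = pA a * pC c * pY a c y * ∑ b, pB b * pZ a b z := by
    intro a c y z
    simp only [hWd, hp]
    rw [Finset.sum_comm, Finset.mul_sum]
    refine Finset.sum_congr rfl fun b _ => ?_
    rw [← Finset.sum_mul, ← Finset.sum_mul, ← Finset.mul_sum, hpX1]; ring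
  have E2 : ∀ a c x y, ∑ z, W a c x y z = pA a * pC c * pY a c y * ∑ b, pB b * pX b c x := by
    intro a c x y
    simp only [hWd, hp]
    rw [Finset.sum_comm, Finset.mul_sum]
    refine Finset.sum_congr rfl fun b _ => ?_
    rw [← Finset.mul_sum, hpZ1]; ring
  have mAYZ : ∀ a y z, ∑ c, ∑ x, W a c x y z
      = pA a * (∑ c, pC c * pY a c y) * ∑ b, pB b * pZ a b z := by
    intro a y z
    simp only [E1]
    rw [← Finset.sum_mul]
    congr 1
    rw [Finset.mul_sum]
    refine Finset.sum_congr rfl fun c _ => ?_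
    ring
  have mCXY : ∀ c x y, ∑ a, ∑ z, W a c x y z
      = pC c * (∑ b, pB b * pX b c x) * ∑ a, pA a * pY a c y := by
    intro c x y
    simp only [E2]
    rw [← Finset.sum_mul, mul_right_comm]
    congr 1
    rw [Finset.mul_sum]
    refine Finset.sum_congr rfl fun c _ => ?_
    ring
  have mACX : ∀ a c x, ∑ y, ∑ z, W a c x y z = pA a * (pC c * ∑ b, pB b * pX b c x) := by
    intro a c x
    simp only [E2]
    rw [← Finset.sum_mul, ← Finset.mul_sum, hpY1]; ring
  have mAX : ∀ a x, ∑ c, ∑ y, ∑ z, W a c x y z = pA a * ∑ c, pC c * ∑ b, pB b * pX b c x := by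
    intro a x
    simp only [mACX]
    rw [← Finset.mul_sum]
  have mCZ : ∀ c z, ∑ a, ∑ x, ∑ y, W a c x y z = pC c * ∑ a, pA a * ∑ b, pB b * pZ a b z := by
    intro c z
    rw [Finset.mul_sum]
    refine Finset.sum_congr rfl fun a _ => ?_
    rw [Finset.sum_comm]
    simp only [E1]
    rw [← Finset.sum_mul, ← Finset.mul_sum, hpY1]; ring
  have nX : ∀ c x, 0 ≤ ∑ b, pB b * pX b c x := fun c x =>
    Finset.sum_nonneg fun b _ => mul_nonneg (hpB0 b) (hpX0 b c x)
  have nZ : ∀ a z, 0 ≤ ∑ b, pB b * pZ a b z := fun a z =>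
    Finset.sum_nonneg fun b _ => mul_nonneg (hpB0 b) (hpZ0 a b z)
  have oX : ∀ c, ∑ x, ∑ b, pB b * pX b c x = 1 := fun c =>
    mix_one pB (fun b x => pX b c x) hpB1 (fun b => hpX1 b c)
  have oZ : ∀ a, ∑ z, ∑ b, pB b * pZ a b z = 1 := fun a =>
    mix_one pB (fun b z => pZ a b z) hpB1 (fun b => hpZ1 a b)
  have dU1 : (1 : ℝ) ≤ dU := by exact_mod_cast (by omega : 1 ≤ dU)
  have dO1 : (1 : ℝ) ≤ dO := by exact_mod_cast (by omega : 1 ≤ dO)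
  have cA : (Fintype.card A : ℝ) = dU := by rw [hA]
  have cC : (Fintype.card C : ℝ) = dU := by rw [hC]
  have cX : (Fintype.card X : ℝ) = dO := by rw [hX]
  have cY : (Fintype.card Y : ℝ) = dO := by rw [hY]
  have cZ : (Fintype.card Z : ℝ) = dO := by rw [hZ]
  have cCX : (Fintype.card (C × X) : ℝ) = dU * dO := by
    rw [Fintype.card_prod, hC, hX]; push_cast; ring
  have k1 := ci q hq (fun a y z => ∑ c, ∑ x, W a c x y z) pA (fun a y => ∑ c, pC c * pY a c y)
    (fun a z => ∑ b, pB b * pZ a b z) hpA0 hpA1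
    (fun a y => Finset.sum_nonneg fun c _ => mul_nonneg (hpC0 c) (hpY0 a c y))
    (fun a => mix_one pC (fun c y => pY a c y) hpC1 (fun c => hpY1 a c))
    nZ oZ mAYZ (fun a y => ∑ c, ∑ x, ∑ z, W a c x y z) (fun a z => ∑ c, ∑ x, ∑ y, W a c x y z)
    (fun a => ∑ c, ∑ x, ∑ y, ∑ z, W a c x y z)
    (fun _ _ => push2 _) (fun _ _ => push2 _) (fun a => push2 (fun y c x => ∑ z, W a c x y z)) dO dO cY cZ dO1 dO1
  have k2 := ci q hq (fun c x y => ∑ a, ∑ z, W a c x y z) pC (fun c x => ∑ b, pB b * pX b c x)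
    (fun c y => ∑ a, pA a * pY a c y) hpC0 hpC1 nX oX
    (fun c y => Finset.sum_nonneg fun a _ => mul_nonneg (hpA0 a) (hpY0 a c y))
    (fun c => mix_one pA (fun a y => pY a c y) hpA1 (fun a => hpY1 a c))
    mCXY (fun c x => ∑ a, ∑ y, ∑ z, W a c x y z) (fun c y => ∑ a, ∑ x, ∑ z, W a c x y z)
    (fun c => ∑ a, ∑ x, ∑ y, ∑ z, W a c x y z)
    (fun _ _ => Finset.sum_comm) (fun _ _ => Finset.sum_comm) (fun c => Finset.sum_comm (f := fun x a => ∑ y, ∑ z, W a c x y z))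
    dO dO cX cY dO1 dO1
  have k3 := ci0 q hq (fun c z => ∑ a, ∑ x, ∑ y, W a c x y z) pC
    (fun z => ∑ a, pA a * ∑ b, pB b * pZ a b z) hpC0 hpC1
    (fun z => Finset.sum_nonneg fun a _ => mul_nonneg (hpA0 a) (nZ a z))
    (mix_one pA (fun a z => ∑ b, pB b * pZ a b z) hpA1 oZ) mCZ
    (fun c => ∑ a, ∑ x, ∑ y, ∑ z, W a c x y z) (fun z => ∑ a, ∑ c, ∑ x, ∑ y, W a c x y z)
    (fun _ => push3 _) (fun z => Finset.sum_comm (f := fun c a => ∑ x, ∑ y, W a c x y z)) dU dO cC cZ dU1 dO1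
  have k4 := ci0 q hq (fun a x => ∑ c, ∑ y, ∑ z, W a c x y z) pA
    (fun x => ∑ c, pC c * ∑ b, pB b * pX b c x) hpA0 hpA1
    (fun x => Finset.sum_nonneg fun c _ => mul_nonneg (hpC0 c) (nX c x))
    (mix_one pC (fun c x => ∑ b, pB b * pX b c x) hpC1 oX) mAX
    (fun a => ∑ c, ∑ x, ∑ y, ∑ z, W a c x y z) (fun x => ∑ a, ∑ c, ∑ y, ∑ z, W a c x y z)
    (fun a => Finset.sum_comm (f := fun x c => ∑ y, ∑ z, W a c x y z)) (fun _ => rfl) dU dO cA cX dU1 dO1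
  have k5 := ci0 q hq (fun a (k : C × X) => ∑ y, ∑ z, W a k.1 k.2 y z) pA
    (fun k => pC k.1 * ∑ b, pB b * pX b k.1 k.2) hpA0 hpA1
    (fun k => mul_nonneg (hpC0 _) (nX _ _))
    (by rw [Fintype.sum_prod_type]; simp only [← Finset.mul_sum, oX, mul_one, hpC1])
    (fun _ _ => mACX _ _ _)
    (fun a => ∑ c, ∑ x, ∑ y, ∑ z, W a c x y z) (fun k => ∑ a, ∑ y, ∑ z, W a k.1 k.2 y z)
    (fun _ => by rw [Fintype.sum_prod_type]) (fun _ => rfl) dU (dU * dO) cA cCX dU1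
    (by nlinarith)
  simp only [Fintype.sum_prod_type] at k5
  have kc := core q hq W hW0
  have gX : ∀ x, ∑ a, ∑ b, ∑ c, ∑ y, ∑ z, p (a, b, c, x, y, z)
      = ∑ a, ∑ c, ∑ y, ∑ z, W a c x y z := by
    intro x; simp only [hWd]; exact Finset.sum_congr rfl fun _ _ => push3 _
  have gY : ∀ y, ∑ a, ∑ b, ∑ c, ∑ x, ∑ z, p (a, b, c, x, y, z)
      = ∑ a, ∑ c, ∑ x, ∑ z, W a c x y z := by
    intro x; simp only [hWd]; exact Finset.sum_congr rfl fun _ _ => push3 _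
  have gZ : ∀ z, ∑ a, ∑ b, ∑ c, ∑ x, ∑ y, p (a, b, c, x, y, z)
      = ∑ a, ∑ c, ∑ x, ∑ y, W a c x y z := by
    intro x; simp only [hWd]; exact Finset.sum_congr rfl fun _ _ => push3 _
  have gXY : ∀ x y, ∑ a, ∑ b, ∑ c, ∑ z, p (a, b, c, x, y, z)
      = ∑ a, ∑ c, ∑ z, W a c x y z := by
    intro x y; simp only [hWd]; exact Finset.sum_congr rfl fun _ _ => push2 _
  have gXZ : ∀ x z, ∑ a, ∑ b, ∑ c, ∑ y, p (a, b, c, x, y, z)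
      = ∑ a, ∑ c, ∑ y, W a c x y z := by
    intro x y; simp only [hWd]; exact Finset.sum_congr rfl fun _ _ => push2 _
  have gYZ : ∀ y z, ∑ a, ∑ b, ∑ c, ∑ x, p (a, b, c, x, y, z)
      = ∑ a, ∑ c, ∑ x, W a c x y z := by
    intro x y; simp only [hWd]; exact Finset.sum_congr rfl fun _ _ => push2 _
  have gXYZ : ∀ x y z, ∑ a, ∑ b, ∑ c, p (a, b, c, x, y, z) = ∑ a, ∑ c, W a c x y z := by
    intro x y z; simp only [hWd]; exact Finset.sum_congr rfl fun _ _ => Finset.sum_comm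
  simp only [gX, gY, gZ, gXY, gXZ, gYZ, gXYZ]
  rw [tsallis_eq q hq _ (fun x => by repeat' (refine Finset.sum_nonneg fun _ _ => ?_)
                                     exact hW0 _ _ _ _ _),
    tsallis_eq q hq _ (fun x => by repeat' (refine Finset.sum_nonneg fun _ _ => ?_)
                                   exact hW0 _ _ _ _ _),
    tsallis_eq q hq _ (fun x => by repeat' (refine Finset.sum_nonneg fun _ _ => ?_)
                                   exact hW0 _ _ _ _ _),
    tsallis_eq q hq _ (fun x => by repeat' (refine Finset.sum_nonneg fun _ _ => ?_)
                                   exact hW0 _ _ _ _ _),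
    tsallis_eq q hq _ (fun x => by repeat' (refine Finset.sum_nonneg fun _ _ => ?_)
                                   exact hW0 _ _ _ _ _),
    tsallis_eq q hq _ (fun x => by repeat' (refine Finset.sum_nonneg fun _ _ => ?_)
                                   exact hW0 _ _ _ _ _),
    tsallis_eq q hq _ (fun x => by repeat' (refine Finset.sum_nonneg fun _ _ => ?_)
                                   exact hW0 _ _ _ _ _)]
  simp only [Fintype.sum_prod_type]
  have hU0 : (0 : ℝ) < dU := by linarith
  have hO0 : (0 : ℝ) < dO := by linarith
  have r1 : (dU : ℝ) ^ (2 - 2 * q) = (dU : ℝ) ^ (1 - q) * (dU : ℝ) ^ (1 - q) := by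
    rw [← Real.rpow_add hU0]; congr 1; ring
  have r2 : (dO : ℝ) ^ (2 - 2 * q) = (dO : ℝ) ^ (1 - q) * (dO : ℝ) ^ (1 - q) := by
    rw [← Real.rpow_add hO0]; congr 1; ring
  rw [Real.mul_rpow hU0.le hO0.le] at k5
  unfold B3
  rw [r1, r2]
  generalize (dU : ℝ) ^ (1 - q) = u at *
  generalize (dO : ℝ) ^ (1 - q) = o at *
  have hq1 : 0 < q - 1 := by linarith
  rw [ge_iff_le, ← sub_nonneg]
  have fin : ∀ a b c d e f g t : ℝ,
      0 ≤ 3 * a + 3 * b + 3 * c - 2 * d - 2 * e - 3 * f + g - 3 + t →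
      0 ≤ -3 * ((1 - a) / (q - 1)) - 3 * ((1 - b) / (q - 1)) - 3 * ((1 - c) / (q - 1))
        + 2 * ((1 - d) / (q - 1)) + 2 * ((1 - e) / (q - 1)) + 3 * ((1 - f) / (q - 1))
        - (1 - g) / (q - 1) - -(1 / (q - 1)) * t := by
    intro a b c d e f g t h
    have := div_nonneg h hq1.le
    refine this.trans_eq ?_
    field_simp
    ring
  apply fin
  linarith
end

section
/- Let v be a unit vector in the complex vector space indexed by triples (a,b,c) ∈ Fin d_A × Fin d_B × Fin d_C and let ρ_{ABC} = v v† be the corresponding pure density matrix. Then for every real q > 1, the conditional quantum Tsallis mutual information is nonnegative: I_q(A:B|C) = S_q(ρ_{AC}) + S_q(ρ_{BC}) − S_q(ρ_C) − S_q(ρ_{ABC}) ≥ 0, where ρ_{AC}, ρ_{BC}, ρ_C are the partial traces of ρ_{ABC}. (Thus strong subadditivity of Tsallis entropy, which fails in general for q > 1, holds for pure tripartite states.) -/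
open Finset Matrix

/-- Quantum Tsallis entropy of order `q` of a matrix `ρ` (intended: a density
matrix), defined via the eigenvalues of `ρ` when `ρ` is Hermitian, with the sum
restricted to the strictly positive eigenvalues. -/
noncomputable def qTsallis {n : Type*} [Fintype n] [DecidableEq n]
    (q : ℝ) (ρ : Matrix n n ℂ) : ℝ :=
  if h : ρ.IsHermitian then
    (1 / (1 - q)) * ((∑ i ∈ univ.filter (fun i => 0 < h.eigenvalues i),
      h.eigenvalues i ^ q) - 1)
  else 0

/-- Partial trace over the second factor of a tripartite matrix. -/
noncomputable def ptraceB {α β γ : Type*} [Fintype β]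
    (ρ : Matrix (α × β × γ) (α × β × γ) ℂ) : Matrix (α × γ) (α × γ) ℂ :=
  Matrix.of fun w w' => ∑ b, ρ (w.1, b, w.2) (w'.1, b, w'.2)

/-- Partial trace over the first factor of a tripartite matrix. -/
noncomputable def ptraceA {α β γ : Type*} [Fintype α]
    (ρ : Matrix (α × β × γ) (α × β × γ) ℂ) : Matrix (β × γ) (β × γ) ℂ :=
  Matrix.of fun w w' => ∑ a, ρ (a, w.1, w.2) (a, w'.1, w'.2)

/-- Partial trace over the first two factors of a tripartite matrix. -/
noncomputable def ptraceAB {α β γ : Type*} [Fintype α] [Fintype β]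
    (ρ : Matrix (α × β × γ) (α × β × γ) ℂ) : Matrix γ γ ℂ :=
  Matrix.of fun c c' => ∑ a, ∑ b, ρ (a, b, c) (a, b, c')

open scoped Kronecker ComplexOrder

namespace TsallisAux

noncomputable def G {n : Type*} [Fintype n] [DecidableEq n] (q : ℝ) (M : Matrix n n ℂ) : ℝ :=
  (M.charpoly.roots.map (fun z : ℂ => z.re ^ q)).sum

lemma G_eq {n : Type*} [Fintype n] [DecidableEq n] (q : ℝ) {M : Matrix n n ℂ}
    (h : M.IsHermitian) : G q M = ∑ i, h.eigenvalues i ^ q := by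
  unfold G
  rw [h.roots_charpoly_eq_eigenvalues, Multiset.map_map]
  simp

lemma qTsallis_eq {n : Type*} [Fintype n] [DecidableEq n] (q : ℝ) (hq : 1 < q)
    {M : Matrix n n ℂ} (h : M.PosSemidef) : qTsallis q M = (1 / (1 - q)) * (G q M - 1) := by
  unfold qTsallis
  rw [dif_pos h.1, G_eq q h.1, Finset.sum_filter]
  congr 2
  refine Finset.sum_congr rfl fun i _ => ?_
  split_ifs with hi
  · rfl
  · have : h.1.eigenvalues i = 0 := le_antisymm (not_lt.mp hi) (h.eigenvalues_nonneg i)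
    rw [this, Real.zero_rpow (by linarith)]

lemma G_mul_comm {m n : Type*} [Fintype n] [DecidableEq n] [Fintype m] [DecidableEq m]
    (q : ℝ) (hq : 1 < q) (A : Matrix m n ℂ) (B : Matrix n m ℂ) :
    G q (A * B) = G q (B * A) := by
  have h := congrArg (fun p : Polynomial ℂ => (p.roots.map (fun z : ℂ => z.re ^ q)).sum)
    (Matrix.charpoly_mul_comm' A B)
  have h1 : ∀ (k : ℕ) (p : Polynomial ℂ), p.Monic →
      ((Polynomial.X ^ k * p).roots.map (fun z : ℂ => z.re ^ q)).sum
      = (p.roots.map (fun z : ℂ => z.re ^ q)).sum := by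
    intro k p hp
    rw [Polynomial.roots_mul ((Polynomial.monic_X_pow k).mul hp).ne_zero]
    simp [Multiset.map_nsmul, Multiset.sum_nsmul, Real.zero_rpow (by linarith : q ≠ 0)]
  beta_reduce at h
  rw [h1 _ _ (Matrix.charpoly_monic _), h1 _ _ (Matrix.charpoly_monic _)] at h
  exact h

lemma G_transpose {n : Type*} [Fintype n] [DecidableEq n] (q : ℝ) (M : Matrix n n ℂ) :
    G q Mᵀ = G q M := by
  unfold G; rw [Matrix.charpoly_transpose]

lemma G_dual {m n : Type*} [Fintype n] [DecidableEq n] [Fintype m] [DecidableEq m]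
    (q : ℝ) (hq : 1 < q) (A : Matrix m n ℂ) :
    G q (Aᵀ * Aᵀᴴ) = G q (A * Aᴴ) := by
  rw [G_mul_comm q hq A, ← G_transpose q (Aᴴ * A)]
  rw [Matrix.transpose_mul]
  rfl

lemma peierls {n : Type*} [Fintype n] [DecidableEq n] (q : ℝ) (hq : 1 < q)
    {M : Matrix n n ℂ} (h : M.PosSemidef) : ∑ i, (M i i).re ^ q ≤ G q M := by
  rw [G_eq q h.1]
  set V : Matrix n n ℂ := h.1.eigenvectorUnitary.val with hV
  set l := h.1.eigenvalues with hl
  have hVV : V * star V = 1 := Unitary.coe_mul_star_self _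
  have hVV' : star V * V = 1 := Unitary.coe_star_mul_self _
  have hM : ∀ i, (M i i).re = ∑ k, Complex.normSq (V i k) * l k := by
    intro i
    have := h.1.spectral_theorem
    rw [Unitary.conjStarAlgAut_apply] at this
    conv_lhs => rw [this]
    change ((V * (diagonal (RCLike.ofReal ∘ l) : Matrix n n ℂ) * star V : Matrix n n ℂ) i i).re = _
    rw [Matrix.mul_apply, Complex.re_sum]
    refine Finset.sum_congr rfl fun k _ => ?_
    rw [Matrix.mul_diagonal, Matrix.star_apply]
    simp [Complex.normSq_apply]
    ring
  have hr : ∀ i, ∑ k, Complex.normSq (V i k) = 1 := by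
    intro i
    have := congrArg Complex.re (congrFun (congrFun hVV i) i)
    rw [Matrix.mul_apply, Complex.re_sum] at this
    simpa [Complex.normSq_apply] using this
  have hc : ∀ k, ∑ i, Complex.normSq (V i k) = 1 := by
    intro i
    have := congrArg Complex.re (congrFun (congrFun hVV' i) i)
    rw [Matrix.mul_apply, Complex.re_sum] at this
    simpa [Complex.normSq_apply] using this
  calc ∑ i, (M i i).re ^ q ≤ ∑ i, ∑ k, Complex.normSq (V i k) * l k ^ q := by
        refine Finset.sum_le_sum fun i _ => ?_
        rw [hM i]
        exact Real.rpow_arith_mean_le_arith_mean_rpow _ _ _ (fun k _ => Complex.normSq_nonneg _)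
          (hr i) (fun k _ => h.eigenvalues_nonneg k) hq.le
    _ = ∑ k, l k ^ q := by
        rw [Finset.sum_comm]
        refine Finset.sum_congr rfl fun k _ => ?_
        rw [← Finset.sum_mul, hc, one_mul]

lemma classical {m n : Type*} [Fintype m] [Fintype n] (q : ℝ) (hq : 1 < q)
    (D : m → n → ℝ) (hD : ∀ i j, 0 ≤ D i j) (h1 : ∑ i, ∑ j, D i j = 1) :
    ∑ i, (∑ j, D i j) ^ q + ∑ j, (∑ i, D i j) ^ q ≤ 1 + ∑ i, ∑ j, D i j ^ q := by
  set a : m → ℝ := fun i => ∑ j, D i j with ha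
  have ha0 : ∀ i, 0 ≤ a i := fun i => Finset.sum_nonneg fun j _ => hD i j
  have ha1 : ∀ i, a i ≤ 1 := fun i => by
    rw [← h1]; exact Finset.single_le_sum (f := a) (fun i _ => ha0 i) (Finset.mem_univ i)
  have hz : ∀ i, a i = 0 → ∀ j, D i j = 0 := fun i hi j =>
    (Finset.sum_eq_zero_iff_of_nonneg (fun j _ => hD i j)).1 hi j (Finset.mem_univ j)
  have hDp : ∀ i j, D i j = a i * (D i j / a i) := fun i j => by
    by_cases h : a i = 0
    · simp [h, hz i h j]
    · field_simp
  have hp0 : ∀ i j, 0 ≤ D i j / a i := fun i j => div_nonneg (hD i j) (ha0 i)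
  have hJ : ∀ j, (∑ i, D i j) ^ q ≤ ∑ i, a i * (D i j / a i) ^ q := fun j => by
    have := Real.rpow_arith_mean_le_arith_mean_rpow univ a (fun i => D i j / a i)
      (fun i _ => ha0 i) h1 (fun i _ => hp0 i j) hq.le
    simpa only [← hDp] using this
  have key : ∀ i, a i ^ q + ∑ j, a i * (D i j / a i) ^ q ≤ a i + ∑ j, D i j ^ q := fun i => by
    have e : ∑ j, D i j ^ q = a i ^ q * ∑ j, (D i j / a i) ^ q := by
      rw [Finset.mul_sum]
      refine Finset.sum_congr rfl fun j _ => ?_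
      rw [← Real.mul_rpow (ha0 i) (hp0 i j), ← hDp]
    rw [e, ← Finset.mul_sum]
    by_cases h : a i = 0
    · simp [h, Real.zero_rpow (by linarith : q ≠ 0)]
    have s1 : ∑ j, (D i j / a i) = 1 := by
      rw [← Finset.sum_div]; exact div_self h
    have s2 : ∑ j, (D i j / a i) ^ q ≤ 1 := by
      rw [← s1]
      refine Finset.sum_le_sum fun j _ => ?_
      refine Real.rpow_le_self_of_le_one (hp0 i j) ?_ hq.le
      rw [← s1]
      exact Finset.single_le_sum (f := fun j => D i j / a i) (fun j _ => hp0 i j) (Finset.mem_univ j)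
    have s3 : a i ^ q ≤ a i := Real.rpow_le_self_of_le_one (ha0 i) (ha1 i) hq.le
    nlinarith [mul_nonneg (sub_nonneg.2 s2) (sub_nonneg.2 s3)]
  have t1 := Finset.sum_le_sum fun j (_ : j ∈ univ) => hJ j
  rw [Finset.sum_comm] at t1
  have t2 := Finset.sum_le_sum fun i (_ : i ∈ univ) => key i
  rw [Finset.sum_add_distrib, Finset.sum_add_distrib] at t2
  have : ∑ i, a i = 1 := h1
  linarith

lemma diag_unit {n : Type*} [Fintype n] [DecidableEq n] {M : Matrix n n ℂ}
    (h : M.IsHermitian) (i : n) :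
    ((star (h.eigenvectorUnitary : Matrix n n ℂ) * M * h.eigenvectorUnitary) i i).re
      = h.eigenvalues i := by
  have := h.conjStarAlgAut_star_eigenvectorUnitary
  rw [Unitary.conjStarAlgAut_star_apply] at this
  rw [this]; simp

lemma subadd {m n : Type*} [Fintype m] [Fintype n] [DecidableEq m] [DecidableEq n]
    (q : ℝ) (hq : 1 < q) (σ : Matrix (m × n) (m × n) ℂ) (hσ : σ.PosSemidef) (ht : σ.trace = 1)
    (A : Matrix m m ℂ) (B : Matrix n n ℂ) (hA : A.IsHermitian) (hB : B.IsHermitian)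
    (eA : ∀ i i', A i i' = ∑ j, σ (i, j) (i', j)) (eB : ∀ j j', B j j' = ∑ i, σ (i, j) (i, j')) :
    G q A + G q B ≤ 1 + G q σ := by
  set U : Matrix m m ℂ := hA.eigenvectorUnitary.val with hU
  set V : Matrix n n ℂ := hB.eigenvectorUnitary.val with hV
  have hUU : U * Uᴴ = 1 := Unitary.coe_mul_star_self _
  have hVV : V * Vᴴ = 1 := Unitary.coe_mul_star_self _
  set W := U ⊗ₖ V with hW
  have hWW : W * Wᴴ = 1 := by
    rw [hW, Matrix.conjTranspose_kronecker, ← Matrix.mul_kronecker_mul, hUU, hVV,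
      Matrix.one_kronecker_one]
  set τ := Wᴴ * σ * W with hτ
  have hτp : τ.PosSemidef := hσ.conjTranspose_mul_mul_same W
  have hG : G q τ = G q σ := by
    rw [hτ, G_mul_comm q hq, ← Matrix.mul_assoc, hWW, Matrix.one_mul]
  have hT : τ.trace = 1 := by
    rw [hτ, Matrix.trace_mul_comm, ← Matrix.mul_assoc, hWW, Matrix.one_mul, ht]
  have mA : ∀ X, (σ * (X ⊗ₖ (1 : Matrix n n ℂ))).trace = (A * X).trace := by
    intro X
    simp only [Matrix.trace, Matrix.diag, Matrix.mul_apply, Fintype.sum_prod_type,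
      Matrix.kronecker_apply, Matrix.one_apply, eA]
    simp only [mul_ite, mul_one, mul_zero, Finset.sum_ite_eq', Finset.sum_ite_eq, Finset.mem_univ,
      if_true, Finset.sum_mul]
    refine Finset.sum_congr rfl fun i _ => ?_
    rw [Finset.sum_comm]
  have mB : ∀ X, (σ * ((1 : Matrix m m ℂ) ⊗ₖ X)).trace = (B * X).trace := by
    intro X
    simp only [Matrix.trace, Matrix.diag, Matrix.mul_apply, Fintype.sum_prod_type,
      Matrix.kronecker_apply, Matrix.one_apply, eB, Finset.sum_mul]
    rw [Finset.sum_comm]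
    refine Finset.sum_congr rfl fun j _ => ?_
    rw [Finset.sum_comm' (t' := univ) (s' := fun _ => univ) (by simp)]
    conv_rhs => rw [Finset.sum_comm]
    simp
  have tA : ∀ i, ∑ j, (τ (i, j) (i, j)).re = hA.eigenvalues i := by
    intro i
    have e : ∑ j, τ (i, j) (i, j) = (τ * (Matrix.single i i 1 ⊗ₖ (1 : Matrix n n ℂ))).trace := by
      simp [Matrix.trace, Matrix.mul_apply, Fintype.sum_prod_type, Matrix.one_apply,
        Matrix.single_apply, ite_and]
    rw [← Complex.re_sum, e, ← diag_unit hA i]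
    congr 1
    calc (τ * (Matrix.single i i 1 ⊗ₖ (1 : Matrix n n ℂ))).trace
        = (σ * (W * (Matrix.single i i 1 ⊗ₖ (1 : Matrix n n ℂ)) * Wᴴ)).trace := by
          rw [hτ, Matrix.mul_assoc, Matrix.mul_assoc, Matrix.trace_mul_comm]
          simp only [Matrix.mul_assoc]
      _ = (σ * ((U * Matrix.single i i 1 * Uᴴ) ⊗ₖ (1 : Matrix n n ℂ))).trace := by
          rw [hW, Matrix.conjTranspose_kronecker, ← Matrix.mul_kronecker_mul,
            ← Matrix.mul_kronecker_mul, Matrix.mul_one, hVV]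
      _ = (Uᴴ * A * U * Matrix.single i i 1).trace := by
          rw [mA, Matrix.trace_mul_comm, Matrix.mul_assoc, Matrix.trace_mul_comm]
          simp only [Matrix.mul_assoc]
      _ = _ := by
          simp [Matrix.trace_mul_single]
          rfl
  have tB : ∀ j, ∑ i, (τ (i, j) (i, j)).re = hB.eigenvalues j := by
    intro i
    have e : ∑ j, τ (j, i) (j, i) = (τ * ((1 : Matrix m m ℂ) ⊗ₖ Matrix.single i i 1)).trace := by
      simp [Matrix.trace, Matrix.mul_apply, Fintype.sum_prod_type, Matrix.one_apply,
        Matrix.single_apply, ite_and]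
    rw [← Complex.re_sum, e, ← diag_unit hB i]
    congr 1
    calc (τ * ((1 : Matrix m m ℂ) ⊗ₖ Matrix.single i i 1)).trace
        = (σ * (W * ((1 : Matrix m m ℂ) ⊗ₖ Matrix.single i i 1) * Wᴴ)).trace := by
          rw [hτ, Matrix.mul_assoc, Matrix.mul_assoc, Matrix.trace_mul_comm]
          simp only [Matrix.mul_assoc]
      _ = (σ * ((1 : Matrix m m ℂ) ⊗ₖ (V * Matrix.single i i 1 * Vᴴ))).trace := by
          rw [hW, Matrix.conjTranspose_kronecker, ← Matrix.mul_kronecker_mul,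
            ← Matrix.mul_kronecker_mul, Matrix.mul_one, hUU]
      _ = (Vᴴ * B * V * Matrix.single i i 1).trace := by
          rw [mB, Matrix.trace_mul_comm, Matrix.mul_assoc, Matrix.trace_mul_comm]
          simp only [Matrix.mul_assoc]
      _ = _ := by
          simp [Matrix.trace_mul_single]
          rfl
  have c := classical q hq (fun i j => (τ (i, j) (i, j)).re)
    (fun i j => (Complex.nonneg_iff.1 (hτp.diag_nonneg (i := (i, j)))).1) (by
      have := congrArg Complex.re hT
      simpa [Matrix.trace, Fintype.sum_prod_type] using this)
  simp only [tA, tB] at c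
  have p := peierls q hq hτp
  rw [Fintype.sum_prod_type, hG] at p
  rw [G_eq q hA, G_eq q hB]
  linarith

lemma G_pure {n : Type*} [Fintype n] [DecidableEq n] (q : ℝ) (hq : 1 < q) (v : n → ℂ)
    (hv : star v ⬝ᵥ v = 1) : G q (Matrix.vecMulVec v (star v)) = 1 := by
  rw [Matrix.vecMulVec_eq Unit, G_mul_comm q hq]
  have : Matrix.replicateRow Unit (star v) * Matrix.replicateCol Unit v = 1 := by
    ext i j
    simpa [Matrix.mul_apply, dotProduct] using hv
  rw [this]
  have h1 : (Polynomial.X - 1 : Polynomial ℂ).roots = {1} := by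
    rw [← Polynomial.C_1, Polynomial.roots_X_sub_C]
  simp [G, Matrix.charpoly_one, h1]

end TsallisAux

open TsallisAux in
/-- Strong subadditivity of quantum Tsallis entropies for pure tripartite states:
for a unit vector `v` and the pure state `ρ = v v†`, the conditional quantum
Tsallis mutual information `I_q(A:B|C)` is nonnegative for every `q > 1`. -/
theorem quantum_tsallis_ssa_pure
    {dA dB dC : ℕ} (v : Fin dA × Fin dB × Fin dC → ℂ)
    (hv : star v ⬝ᵥ v = 1)
    (ρ : Matrix (Fin dA × Fin dB × Fin dC) (Fin dA × Fin dB × Fin dC) ℂ)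
    (hρ : ρ = Matrix.vecMulVec v (star v))
    (q : ℝ) (hq : 1 < q) :
    0 ≤ qTsallis q (ptraceB ρ) + qTsallis q (ptraceA ρ)
        - qTsallis q (ptraceAB ρ) - qTsallis q ρ := by
  let M : Matrix (Fin dA × Fin dC) (Fin dB) ℂ := Matrix.of fun w b => v (w.1, b, w.2)
  let N : Matrix (Fin dB × Fin dC) (Fin dA) ℂ := Matrix.of fun w a => v (a, w.1, w.2)
  let P : Matrix (Fin dC) (Fin dA × Fin dB) ℂ := Matrix.of fun c w => v (w.1, w.2, c)
  have eM : ptraceB ρ = M * Mᴴ := by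
    ext w w'
    simp [ptraceB, hρ, Matrix.mul_apply, Matrix.vecMulVec_apply, M]
  have eN : ptraceA ρ = N * Nᴴ := by
    ext w w'
    simp [ptraceA, hρ, Matrix.mul_apply, Matrix.vecMulVec_apply, N]
  have eP : ptraceAB ρ = P * Pᴴ := by
    ext w w'
    simp [ptraceAB, hρ, Matrix.mul_apply, Matrix.vecMulVec_apply, P, Fintype.sum_prod_type]
  have hp : ρ.PosSemidef := by rw [hρ]; exact Matrix.posSemidef_vecMulVec_self_star v
  rw [eM, eN, eP, qTsallis_eq q hq (Matrix.posSemidef_self_mul_conjTranspose M),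
    qTsallis_eq q hq (Matrix.posSemidef_self_mul_conjTranspose N),
    qTsallis_eq q hq (Matrix.posSemidef_self_mul_conjTranspose P), qTsallis_eq q hq hp,
    hρ, G_pure q hq v hv, ← G_dual q hq M, ← G_dual q hq N, ← G_dual q hq P]
  have key := subadd q hq (Pᵀ * Pᵀᴴ) (Matrix.posSemidef_self_mul_conjTranspose _) (by
      rw [← hv]
      simp only [Matrix.trace, Matrix.diag, Matrix.mul_apply, Fintype.sum_prod_type, dotProduct,
        Matrix.conjTranspose_apply, Matrix.transpose_apply, Pi.star_apply, P]
      refine Finset.sum_congr rfl fun a _ => Finset.sum_congr rfl fun b _ =>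
        Finset.sum_congr rfl fun c _ => mul_comm _ _)
    (Nᵀ * Nᵀᴴ) (Mᵀ * Mᵀᴴ)
    (Matrix.isHermitian_mul_conjTranspose_self _) (Matrix.isHermitian_mul_conjTranspose_self _)
    (by
      intro i i'
      simp [Matrix.mul_apply, Fintype.sum_prod_type, M, N, P])
    (by
      intro i i'
      simp [Matrix.mul_apply, Fintype.sum_prod_type, M, N, P])
  have h0 : 1 / (1 - q) ≤ 0 := one_div_nonpos.2 (by linarith)
  nlinarith [mul_nonneg (neg_nonneg.2 h0) (sub_nonneg.2 key)]
end
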